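/- Let k ≥ 2 be an integer, n ≥ 3, 0 ≤ a < (n-2)/2, 0 < b, a ≤ b < a+1, p = 2n/(n-2+2(b-a)), and let κ_{ij} > 0 and α_{ij}, β_{ij} > 1 with α_{ij} + β_{ij} = p for all 1 ≤ i, j ≤ k. Let (u₁, …, u_k) and (v₁, …, v_k) be two positive finite-energy solutions of the k-coupled Hénon–Sobolev system (S_k), with each u_i and v_i continuous on all of ℝⁿ. If u_i(0) = v_i(0) for all 1 ≤ i ≤ k, then u_i ≡ v_i on ℝⁿ for all 1 ≤ i ≤ k. -/

import Mathlib

open MeasureTheory Real Filter Topology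

noncomputable section

/-- Coordinate Laplacian on Euclidean space. -/
def lapl {n : ℕ} (w : EuclideanSpace ℝ (Fin n) → ℝ) (x : EuclideanSpace ℝ (Fin n)) : ℝ :=
  ∑ i : Fin n, fderiv ℝ (fun y => fderiv ℝ w y (EuclideanSpace.single i 1)) x
    (EuclideanSpace.single i 1)

/-- The weighted divergence `div(|x|^(-2a) ∇w)(x) = |x|^(-2a) (Δw(x) - 2a⟨x,∇w(x)⟩/|x|²)`. -/
def wdiv {n : ℕ} (a : ℝ) (w : EuclideanSpace ℝ (Fin n) → ℝ) (x : EuclideanSpace ℝ (Fin n)) : ℝ :=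
  ‖x‖ ^ (-(2*a)) * (lapl w x - 2*a * (@inner ℝ _ _ x (gradient w x)) / ‖x‖^2)

/-- Finiteness of the weighted Dirichlet energy `∫ |x|^(-2a) |∇w|² < ∞`. -/
def finiteEnergy {n : ℕ} (a : ℝ) (w : EuclideanSpace ℝ (Fin n) → ℝ) : Prop :=
  Integrable (fun x : EuclideanSpace ℝ (Fin n) => ‖x‖ ^ (-(2*a)) * ‖gradient w x‖^2)

open InnerProductSpace

section Laplacian

variable {E F ι : Type*} [NormedAddCommGroup E] [InnerProductSpace ℝ E]
  [NormedAddCommGroup F] [NormedSpace ℝ F] [Fintype ι]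

lemma ContDiffAt.differentiableAt_fderiv {f : E → F} {x : E} (hf : ContDiffAt ℝ 2 f x) :
    DifferentiableAt ℝ (fderiv ℝ f) x :=
  (hf.fderiv_right (m := 1) (by norm_num)).differentiableAt (by norm_num)

lemma ContDiffAt.hasFDerivAt_fderiv_apply {f : E → F} {x : E} (hf : ContDiffAt ℝ 2 f x) (v : E) :
    HasFDerivAt (fun y => fderiv ℝ f y v) ((fderiv ℝ (fderiv ℝ f) x).flip v) x :=
  by simpa using hf.differentiableAt_fderiv.hasFDerivAt.clm_apply (hasFDerivAt_const v x)

lemma ContDiffAt.eventually_differentiableAt {f : E → F} {x : E} (hf : ContDiffAt ℝ 2 f x) :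
    ∀ᶠ y in 𝓝 x, DifferentiableAt ℝ f y :=
  (hf.eventually (by simp)).mono fun _ hy => hy.differentiableAt (by norm_num)

lemma fderiv_fderiv_apply_eq {f : E → F} {x v : E} {G : E → F} {G' : E →L[ℝ] F}
    (hf : ContDiffAt ℝ 2 f x)
    (h : ∀ᶠ y in 𝓝 x, fderiv ℝ f y v = G y) (hG : HasFDerivAt G G' x) :
    fderiv ℝ (fderiv ℝ f) x v v = G' v := by
  have h1 := hf.hasFDerivAt_fderiv_apply v
  have h2 : HasFDerivAt (fun y => fderiv ℝ f y v) G' x := hG.congr_of_eventuallyEq h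
  have := congrArg (fun L : E →L[ℝ] F => L v) (h1.unique h2)
  simpa using this

lemma hasFDerivAt_norm_rpow' {x : E} (hx : x ≠ 0) (s : ℝ) :
    HasFDerivAt (fun y : E => ‖y‖ ^ s) ((s * ‖x‖ ^ (s - 2)) • innerSL ℝ x) x := by
  have hx' : 0 < ‖x‖ := norm_pos_iff.2 hx
  have h := (hasStrictFDerivAt_norm_sq x).hasFDerivAt.rpow_const (p := s / 2)
    (Or.inl (by positivity))
  have e : (fun y : E => (‖y‖ ^ 2) ^ (s / 2)) = fun y : E => ‖y‖ ^ s := by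
    funext y
    rw [← Real.rpow_natCast, ← Real.rpow_mul (norm_nonneg y)]
    congr 1
    push_cast
    ring
  rw [e] at h
  convert h using 1
  have e2 : (‖x‖ ^ 2) ^ (s / 2 - 1) = ‖x‖ ^ (s - 2) := by
    rw [← Real.rpow_natCast, ← Real.rpow_mul (norm_nonneg x)]
    congr 1
    push_cast
    ring
  rw [e2]
  ext v
  simp
  ring

lemma contDiffAt_norm_rpow {x : E} (hx : x ≠ 0) (s : ℝ) :
    ContDiffAt ℝ 2 (fun y : E => ‖y‖ ^ s) x :=
  (contDiffAt_norm ℝ hx).rpow_const_of_ne (norm_ne_zero_iff.2 hx)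

variable [FiniteDimensional ℝ E]

lemma laplacian_eq_sum_fderiv_fderiv (f : E → F) (v : OrthonormalBasis ι ℝ E) (x : E) :
    Laplacian.laplacian f x = ∑ i, fderiv ℝ (fderiv ℝ f) x (v i) (v i) := by
  rw [laplacian_eq_iteratedFDeriv_orthonormalBasis f v]
  simp [iteratedFDeriv_two_apply]

lemma laplacian_smul_fun {f : E → ℝ} {g : E → F} {x : E} (v : OrthonormalBasis ι ℝ E)
    (hf : ContDiffAt ℝ 2 f x) (hg : ContDiffAt ℝ 2 g x) :
    Laplacian.laplacian (fun y => f y • g y) x = f x • Laplacian.laplacian g x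
      + Laplacian.laplacian f x • g x
      + (2 : ℝ) • ∑ i, fderiv ℝ f x (v i) • fderiv ℝ g x (v i) := by
  have key : ∀ i, fderiv ℝ (fderiv ℝ (fun y => f y • g y)) x (v i) (v i)
      = f x • fderiv ℝ (fderiv ℝ g) x (v i) (v i) + fderiv ℝ (fderiv ℝ f) x (v i) (v i) • g x
        + (2 : ℝ) • (fderiv ℝ f x (v i) • fderiv ℝ g x (v i)) := by
    intro i
    have hG := ((hf.differentiableAt (by norm_num)).hasFDerivAt.smul
      (hg.hasFDerivAt_fderiv_apply (v i))).add
      ((hf.hasFDerivAt_fderiv_apply (v i)).smul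
      (hg.differentiableAt (by norm_num)).hasFDerivAt)
    refine (fderiv_fderiv_apply_eq (hf.smul hg) ?_ hG).trans ?_
    swap
    · simp [two_smul]
      abel
    · filter_upwards [hf.eventually_differentiableAt, hg.eventually_differentiableAt] with y h1 h2
      have := (h1.hasFDerivAt.smul h2.hasFDerivAt).fderiv
      simp only [Pi.add_apply, Pi.smul_apply']
      erw [this]
      simp
  rw [laplacian_eq_sum_fderiv_fderiv _ v, laplacian_eq_sum_fderiv_fderiv _ v,
    laplacian_eq_sum_fderiv_fderiv _ v, Finset.sum_congr rfl fun i _ => key i,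
    Finset.sum_add_distrib, Finset.sum_add_distrib, Finset.smul_sum, Finset.smul_sum,
    Finset.sum_smul]

lemma laplacian_comp {E' : Type*} [NormedAddCommGroup E'] [NormedSpace ℝ E']
    {W : E' → F} {I : E → E'} {x : E} (v : OrthonormalBasis ι ℝ E)
    (hW : ContDiffAt ℝ 2 W (I x)) (hI : ContDiffAt ℝ 2 I x) :
    Laplacian.laplacian (fun y => W (I y)) x =
      ∑ i, fderiv ℝ (fderiv ℝ W) (I x) (fderiv ℝ I x (v i)) (fderiv ℝ I x (v i))
      + fderiv ℝ W (I x) (Laplacian.laplacian I x) := by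
  have key : ∀ i, fderiv ℝ (fderiv ℝ (fun y => W (I y))) x (v i) (v i)
      = fderiv ℝ (fderiv ℝ W) (I x) (fderiv ℝ I x (v i)) (fderiv ℝ I x (v i))
        + fderiv ℝ W (I x) (fderiv ℝ (fderiv ℝ I) x (v i) (v i)) := by
    intro i
    have hdW : DifferentiableAt ℝ (fderiv ℝ W) (I x) :=
      (hW.fderiv_right (m := 1) (by norm_num)).differentiableAt (by norm_num)
    have hG := ((hdW.hasFDerivAt.comp x
      (hI.differentiableAt (by norm_num)).hasFDerivAt).clm_apply
      (hI.hasFDerivAt_fderiv_apply (v i)))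
    refine (fderiv_fderiv_apply_eq (hW.comp x hI) ?_ hG).trans ?_
    swap
    · simp [add_comm]
    · have hW' : ∀ᶠ y in 𝓝 (I x), DifferentiableAt ℝ W y :=
        (hW.eventually (by simp)).mono fun _ hy => hy.differentiableAt (by norm_num)
      filter_upwards [hI.eventually_differentiableAt,
        hI.continuousAt.eventually hW'] with y h1 h2
      have := (h2.hasFDerivAt.comp y h1.hasFDerivAt).fderiv
      erw [this]
      simp
  rw [laplacian_eq_sum_fderiv_fderiv _ v, laplacian_eq_sum_fderiv_fderiv _ v,
    Finset.sum_congr rfl fun i _ => key i, Finset.sum_add_distrib, map_sum]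

lemma laplacian_norm_rpow {x : E} (hx : x ≠ 0) (s : ℝ) :
    Laplacian.laplacian (fun y : E => ‖y‖ ^ s) x
      = s * (s + Module.finrank ℝ E - 2) * ‖x‖ ^ (s - 2) := by
  have hx' : 0 < ‖x‖ := norm_pos_iff.2 hx
  set v := stdOrthonormalBasis ℝ E
  have key : ∀ i, fderiv ℝ (fderiv ℝ (fun y : E => ‖y‖ ^ s)) x (v i) (v i)
      = s * (s - 2) * ‖x‖ ^ (s - 2 - 2) * (inner ℝ (v i) x) ^ 2 + s * ‖x‖ ^ (s - 2) := by
    intro i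
    have hG := ((hasFDerivAt_norm_rpow' hx (s - 2)).const_mul s).mul
      ((innerSL ℝ (v i)).hasFDerivAt (x := x))
    refine (fderiv_fderiv_apply_eq (contDiffAt_norm_rpow hx s) ?_ hG).trans ?_
    swap
    · simp [real_inner_comm]
      ring
    · filter_upwards [isOpen_ne.mem_nhds hx] with y hy
      rw [(hasFDerivAt_norm_rpow' hy s).fderiv]
      simp [real_inner_comm]
  rw [laplacian_eq_sum_fderiv_fderiv _ v, Finset.sum_congr rfl fun i _ => key i,
    Finset.sum_add_distrib, ← Finset.mul_sum, v.sum_sq_inner_right]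
  have : ‖x‖ ^ (s - 2) = ‖x‖ ^ (s - 2 - 2) * ‖x‖ ^ 2 := by
    rw [← Real.rpow_natCast, ← Real.rpow_add hx']
    congr 1
    push_cast
    ring
  simp only [Finset.sum_const, Finset.card_univ, Fintype.card_fin, nsmul_eq_mul]
  rw [this]
  ring

/-- A function cannot have negative Laplacian at a local minimum. -/
lemma IsLocalMin.laplacian_nonneg {f : E → ℝ} {x : E} (hf : ContDiffAt ℝ 2 f x)
    (hmin : IsLocalMin f x) : 0 ≤ Laplacian.laplacian f x := by
  rw [laplacian_eq_sum_fderiv_fderiv _ (stdOrthonormalBasis ℝ E)]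
  refine Finset.sum_nonneg fun i _ => ?_
  set v := stdOrthonormalBasis ℝ E i
  by_contra! hneg
  set γ : ℝ → E := fun t => x + t • v
  have hγ : ∀ t, HasDerivAt γ v t := fun t => by
    simpa [γ] using ((hasDerivAt_id t).smul_const v).const_add x
  have hγ0 : γ 0 = x := by simp [γ]
  have hγc : Tendsto γ (𝓝 0) (𝓝 x) := by
    have := (hγ 0).continuousAt.tendsto
    rwa [hγ0] at this
  have hd : deriv (f ∘ γ) =ᶠ[𝓝 0] fun t => fderiv ℝ f (γ t) v := by
    filter_upwards [hγc.eventually hf.eventually_differentiableAt] with t ht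
    exact (ht.hasFDerivAt.comp_hasDerivAt t (hγ t)).deriv
  have hdd : deriv (deriv (f ∘ γ)) 0 = fderiv ℝ (fderiv ℝ f) x v v := by
    rw [hd.deriv_eq]
    have h1 : HasFDerivAt (fun y => fderiv ℝ f y v) ((fderiv ℝ (fderiv ℝ f) x).flip v) (γ 0) := by
      rw [hγ0]
      exact hf.hasFDerivAt_fderiv_apply v
    exact (h1.comp_hasDerivAt 0 (hγ 0)).deriv
  have hmin' : IsLocalMin (f ∘ γ) 0 := by
    have := hγc.eventually hmin
    simpa [IsLocalMin, IsMinFilter, hγ0] using this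
  have hmax : IsLocalMax (f ∘ γ) 0 := by
    refine isLocalMax_of_deriv_deriv_neg (hdd ▸ hneg) hmin'.deriv_eq_zero ?_
    refine ContinuousAt.comp ?_ (hγ 0).continuousAt
    rw [hγ0]
    exact hf.continuousAt
  have hconst : f ∘ γ =ᶠ[𝓝 0] fun _ => (f ∘ γ) 0 := by
    filter_upwards [hmin', hmax] with t h1 h2
    exact le_antisymm h2 h1
  have : deriv (deriv (f ∘ γ)) 0 = 0 := by
    rw [hconst.deriv.deriv_eq]
    simp
  rw [← hdd, this] at hneg
  exact lt_irrefl _ hneg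

end Laplacian

section Kelvin

variable {E : Type*} [NormedAddCommGroup E] [InnerProductSpace ℝ E]

/-- The Kelvin transform of `w` with respect to the sphere of radius `l` centred at the origin, in
dimension `m + 2`. -/
def kelvin (m : ℕ) (l : ℝ) (w : E → ℝ) (y : E) : ℝ :=
  (l / ‖y‖) ^ m * w ((l / ‖y‖) ^ 2 • y)

lemma hasFDerivAt_sphere_inversion (l : ℝ) {y : E} (hy : y ≠ 0) :
    HasFDerivAt (fun x : E => (l / ‖x‖) ^ 2 • x)
      ((l / ‖y‖) ^ 2 • ((ℝ ∙ y)ᗮ.reflection : E →L[ℝ] E)) y := by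
  have h := EuclideanGeometry.hasFDerivAt_inversion (c := (0 : E)) (R := l) hy
  have e : EuclideanGeometry.inversion (0 : E) l = fun x : E => (l / ‖x‖) ^ 2 • x := by
    funext x
    simp [EuclideanGeometry.inversion]
  rw [e] at h
  simpa using h

lemma contDiffAt_sphere_inversion (l : ℝ) {y : E} (hy : y ≠ 0) :
    ContDiffAt ℝ 2 (fun x : E => (l / ‖x‖) ^ 2 • x) y :=
  ((contDiffAt_const.div (contDiffAt_norm ℝ hy) (norm_ne_zero_iff.2 hy)).pow 2).smul contDiffAt_id

lemma contDiffAt_kelvin {m : ℕ} {l : ℝ} {w : E → ℝ} {y : E} (hy : y ≠ 0)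
    (hw : ContDiffAt ℝ 2 w ((l / ‖y‖) ^ 2 • y)) : ContDiffAt ℝ 2 (kelvin m l w) y :=
  ((contDiffAt_const.div (contDiffAt_norm ℝ hy) (norm_ne_zero_iff.2 hy)).pow m).mul
    (ContDiffAt.comp (g := w) y hw (contDiffAt_sphere_inversion l hy))

lemma sphere_inversion_norm_sq_rpow (l : ℝ) (x : E) :
    (l / ‖x‖) ^ 2 • x = l ^ 2 • (‖x‖ ^ (-2 : ℝ) • x) := by
  rw [smul_smul, div_pow, Real.rpow_neg (norm_nonneg x)]
  norm_num [div_eq_mul_inv]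

lemma div_norm_pow_eq {E : Type*} [NormedAddCommGroup E] (l : ℝ) (m : ℕ) (x : E) :
    (l / ‖x‖) ^ m = l ^ m * ‖x‖ ^ (-(m : ℝ)) := by
  rw [div_pow, Real.rpow_neg (norm_nonneg x), Real.rpow_natCast, div_eq_mul_inv]

variable [FiniteDimensional ℝ E]

lemma laplacian_sphere_inversion {m : ℕ} (hd : Module.finrank ℝ E = m + 2) (l : ℝ) {y : E}
    (hy : y ≠ 0) :
    Laplacian.laplacian (fun x : E => (l / ‖x‖) ^ 2 • x) y
      = (-2 * m * (l / ‖y‖) ^ 2 * (‖y‖ ^ 2)⁻¹) • y := by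
  have hy' : 0 < ‖y‖ := norm_pos_iff.2 hy
  simp_rw [sphere_inversion_norm_sq_rpow]
  set v := stdOrthonormalBasis ℝ E
  have h1 := laplacian_smul (l ^ 2) (f := fun x : E => ‖x‖ ^ (-2 : ℝ) • x) (x := y)
    ((contDiffAt_norm_rpow hy _).smul contDiffAt_id)
  have h2 := laplacian_smul_fun v (contDiffAt_norm_rpow hy (-2)) (contDiffAt_id (x := y))
  have h3 : Laplacian.laplacian (id : E → E) y = 0 := by
    rw [laplacian_eq_sum_fderiv_fderiv _ v]
    have : fderiv ℝ (id : E → E) = fun _ => ContinuousLinearMap.id ℝ E := by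
      funext x; exact fderiv_id
    rw [this]
    simp
  have h4 : ∑ i, fderiv ℝ (fun x : E => ‖x‖ ^ (-2 : ℝ)) y (v i) • fderiv ℝ (id : E → E) y (v i)
      = (-2 * ‖y‖ ^ (-4 : ℝ)) • y := by
    rw [(hasFDerivAt_norm_rpow' hy (-2)).fderiv, fderiv_id]
    simp only [smul_apply, innerSL_apply_apply, ContinuousLinearMap.id_apply,
      smul_assoc, ← Finset.smul_sum]
    simp_rw [real_inner_comm (v _) y]
    rw [v.sum_repr' y]
    norm_num [smul_smul]
  rw [h3, h4, laplacian_norm_rpow hy, hd] at h2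
  have e : (l ^ 2 • fun x : E => ‖x‖ ^ (-2 : ℝ) • x) = fun x : E => l ^ 2 • (‖x‖ ^ (-2 : ℝ) • x) :=
    rfl
  rw [e] at h1
  refine h1.trans ?_
  have e2 : (fun x : E => ‖x‖ ^ (-2 : ℝ) • id x) = fun x : E => ‖x‖ ^ (-2 : ℝ) • x := rfl
  rw [e2] at h2
  rw [h2]
  have e3 : ‖y‖ ^ (-4 : ℝ) = (‖y‖ ^ 2)⁻¹ * (‖y‖ ^ 2)⁻¹ := by
    rw [Real.rpow_neg hy'.le, ← mul_inv, ← pow_add]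
    norm_num
  have e4 : ((-2 : ℝ) - 2) = -4 := by norm_num
  rw [e4, e3]
  simp only [id, smul_zero, zero_add, smul_smul, ← add_smul]
  congr 1
  push_cast
  field_simp
  ring

lemma laplacian_kelvin {m : ℕ} (hd : Module.finrank ℝ E = m + 2) {l : ℝ} {w : E → ℝ} {y : E}
    (hy : y ≠ 0) (hw : ContDiffAt ℝ 2 w ((l / ‖y‖) ^ 2 • y)) :
    Laplacian.laplacian (kelvin m l w) y
      = (l / ‖y‖) ^ (m + 4) * Laplacian.laplacian w ((l / ‖y‖) ^ 2 • y) := by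
  have hy' : 0 < ‖y‖ := norm_pos_iff.2 hy
  set v := stdOrthonormalBasis ℝ E with hv
  set R := (ℝ ∙ y)ᗮ.reflection with hR
  have hI := contDiffAt_sphere_inversion l hy
  have hK : HasFDerivAt (fun x : E => (l / ‖x‖) ^ m)
      ((l ^ m * (-(m : ℝ) * ‖y‖ ^ (-(m : ℝ) - 2))) • innerSL ℝ y) y := by
    simp_rw [div_norm_pow_eq]
    have := (hasFDerivAt_norm_rpow' hy (-(m : ℝ))).const_mul (l ^ m)
    rwa [smul_smul] at this
  have hKc : ContDiffAt ℝ 2 (fun x : E => (l / ‖x‖) ^ m) y :=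
    (contDiffAt_const.div (contDiffAt_norm ℝ hy) (norm_ne_zero_iff.2 hy)).pow m
  have hKl : Laplacian.laplacian (fun x : E => (l / ‖x‖) ^ m) y = 0 := by
    simp_rw [div_norm_pow_eq]
    have := laplacian_smul (l ^ m) (contDiffAt_norm_rpow hy (-(m : ℝ)))
    rw [laplacian_norm_rpow hy, hd] at this
    refine this.trans ?_
    push_cast
    simp
  have h1 := laplacian_smul_fun v hKc
    (ContDiffAt.comp (f := fun x : E => (l / ‖x‖) ^ 2 • x) (g := w) y hw hI)
  have h2 := laplacian_comp (I := fun x : E => (l / ‖x‖) ^ 2 • x) v hw hI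
  rw [laplacian_sphere_inversion hd l hy, (hasFDerivAt_sphere_inversion l hy).fderiv] at h2
  have h3 : HasFDerivAt (w ∘ fun x : E => (l / ‖x‖) ^ 2 • x) _ y :=
    HasFDerivAt.comp (f := fun x : E => (l / ‖x‖) ^ 2 • x) y
      (hw.differentiableAt (by norm_num)).hasFDerivAt (hasFDerivAt_sphere_inversion l hy)
  rw [h3.fderiv, hK.fderiv, hKl] at h1
  have h4 : Laplacian.laplacian w ((l / ‖y‖) ^ 2 • y)
      = ∑ i, fderiv ℝ (fderiv ℝ w) ((l / ‖y‖) ^ 2 • y) (R (v i)) (R (v i)) := by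
    rw [laplacian_eq_sum_fderiv_fderiv _ (v.map R)]
    simp
  have hRy : R y = -y := Submodule.reflection_orthogonalComplement_singleton_eq_neg y
  have h5 : ∑ i, inner ℝ y (v i) * fderiv ℝ w ((l / ‖y‖) ^ 2 • y) (R (v i))
      = - fderiv ℝ w ((l / ‖y‖) ^ 2 • y) y := by
    rw [← map_neg, ← hRy, ← v.sum_repr' y, map_sum, map_sum, v.sum_repr' y]
    refine Finset.sum_congr rfl fun i _ => ?_
    rw [map_smul, map_smul, smul_eq_mul, real_inner_comm]
  refine h1.trans ?_
  have e1 : Laplacian.laplacian (w ∘ fun x : E => (l / ‖x‖) ^ 2 • x) y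
      = (l / ‖y‖) ^ 4 * Laplacian.laplacian w ((l / ‖y‖) ^ 2 • y)
        + (-2 * m * (l / ‖y‖) ^ 2 * (‖y‖ ^ 2)⁻¹) * fderiv ℝ w ((l / ‖y‖) ^ 2 • y) y := by
    refine h2.trans ?_
    rw [h4, Finset.mul_sum]
    congr 1
    · refine Finset.sum_congr rfl fun i _ => ?_
      simp only [smul_apply, map_smul, smul_eq_mul]
      change _ * (_ * fderiv ℝ (fderiv ℝ w) _ (R (v i)) (R (v i))) = _
      ring
    · rw [map_smul, smul_eq_mul]
  rw [e1]
  have e2 : ∀ i, ((l ^ m * (-(m : ℝ) * ‖y‖ ^ (-(m : ℝ) - 2))) • innerSL ℝ y) (v i) •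
      ((fderiv ℝ w ((l / ‖y‖) ^ 2 • y)).comp ((l / ‖y‖) ^ 2 • (R : E →L[ℝ] E))) (v i)
      = (l ^ m * (-(m : ℝ) * ‖y‖ ^ (-(m : ℝ) - 2)) * (l / ‖y‖) ^ 2) *
        (inner ℝ y (v i) * fderiv ℝ w ((l / ‖y‖) ^ 2 • y) (R (v i))) := by
    intro i
    simp only [smul_apply, innerSL_apply_apply, ContinuousLinearMap.comp_apply,
      map_smul, smul_eq_mul]
    change _ * (_ * fderiv ℝ w _ (R (v i))) = _
    ring
  rw [Finset.sum_congr rfl fun i _ => e2 i, ← Finset.mul_sum, h5]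
  have e3 : ‖y‖ ^ (-(m : ℝ) - 2) = (‖y‖ ^ m)⁻¹ * (‖y‖ ^ 2)⁻¹ := by
    rw [Real.rpow_sub hy', Real.rpow_neg hy'.le, Real.rpow_natCast]
    norm_num [div_eq_mul_inv]
  rw [e3]
  simp only [smul_eq_mul, zero_mul, div_pow]
  field_simp
  ring

end Kelvin

section MinimumPrinciple

variable {E : Type*} [NormedAddCommGroup E] [InnerProductSpace ℝ E] [FiniteDimensional ℝ E]

lemma nonneg_of_laplacian_neg {K S : Set E} {f : E → ℝ} (hK : IsCompact K)
    (hc : ContinuousOn f K) (hS : ∀ x ∈ S, 0 ≤ f x)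
    (hinterior : ∀ x ∈ K, x ∉ S → K ∈ 𝓝 x ∧ ContDiffAt ℝ 2 f x ∧ Laplacian.laplacian f x < 0) :
    ∀ x ∈ K, 0 ≤ f x := by
  intro x hx
  obtain ⟨z, hz, hmin⟩ := hK.exists_isMinOn ⟨x, hx⟩ hc
  refine le_trans ?_ (hmin hx)
  by_cases hzS : z ∈ S
  · exact hS z hzS
  · obtain ⟨h1, h2, h3⟩ := hinterior z hz hzS
    exact absurd (IsLocalMin.laplacian_nonneg h2 (hmin.isLocalMin h1)) (not_le.2 h3)

/-- Comparison of a strictly superharmonic function with a radial harmonic function on an annulus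
of the space of dimension `m + 2`. -/
lemma le_of_laplacian_neg_annulus {m : ℕ} (hd : Module.finrank ℝ E = m + 2) {c : E} {r₁ r₂ A B : ℝ}
    (hr₁ : 0 < r₁) {f : E → ℝ}
    (hcont : ∀ x, r₁ ≤ ‖x - c‖ → ‖x - c‖ ≤ r₂ → ContinuousAt f x)
    (hf : ∀ x, r₁ < ‖x - c‖ → ‖x - c‖ < r₂ → ContDiffAt ℝ 2 f x ∧ Laplacian.laplacian f x < 0)
    (h₁ : ∀ x, ‖x - c‖ = r₁ → A + B * (r₁ ^ m)⁻¹ ≤ f x)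
    (h₂ : ∀ x, ‖x - c‖ = r₂ → A + B * (r₂ ^ m)⁻¹ ≤ f x) :
    ∀ x, r₁ ≤ ‖x - c‖ → ‖x - c‖ ≤ r₂ → A + B * (‖x - c‖ ^ m)⁻¹ ≤ f x := by
  set K : Set E := {x | r₁ ≤ ‖x - c‖ ∧ ‖x - c‖ ≤ r₂} with hKdef
  set h : E → ℝ := fun x => A + B * ‖x - c‖ ^ (-(m : ℝ)) with hh
  have hval : ∀ x, h x = A + B * (‖x - c‖ ^ m)⁻¹ := fun x => by
    simp only [hh]
    rw [Real.rpow_neg (norm_nonneg _), Real.rpow_natCast]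
  have hKc : IsCompact K := by
    refine (isCompact_closedBall c r₂).of_isClosed_subset ?_ ?_
    · exact (isClosed_le continuous_const (continuous_id.sub continuous_const).norm).inter
        (isClosed_le (continuous_id.sub continuous_const).norm continuous_const)
    · intro x hx
      simpa [dist_eq_norm] using hx.2
  have hne : ∀ x ∈ K, x - c ≠ 0 := fun x hx => norm_pos_iff.1 (hr₁.trans_le hx.1)
  have hhN : ∀ x ∈ K, ContDiffAt ℝ 2 (fun x => ‖x - c‖ ^ (-(m : ℝ))) x := fun x hx =>
    ContDiffAt.comp (g := fun y : E => ‖y‖ ^ (-(m : ℝ))) x (contDiffAt_norm_rpow (hne x hx) _)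
      (contDiffAt_id.sub contDiffAt_const)
  have hhC : ∀ x ∈ K, ContDiffAt ℝ 2 h x := fun x hx =>
    contDiffAt_const.add (contDiffAt_const.mul (hhN x hx))
  have hhL : ∀ x ∈ K, Laplacian.laplacian h x = 0 := by
    intro x hx
    set v := stdOrthonormalBasis ℝ E
    have t := laplacian_comp (W := fun y : E => A + B * ‖y‖ ^ (-(m : ℝ))) (I := fun x => x - c)
      (x := x) v (contDiffAt_const.add (contDiffAt_const.mul (contDiffAt_norm_rpow (hne x hx) _)))
      (contDiffAt_id.sub contDiffAt_const)
    have e1 : fderiv ℝ (fun x : E => x - c) = fun _ => ContinuousLinearMap.id ℝ E := by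
      funext x
      exact ((hasFDerivAt_id x).sub_const c).fderiv
    have e2 : Laplacian.laplacian (fun x : E => x - c) x = 0 := by
      rw [laplacian_eq_sum_fderiv_fderiv _ v, e1]
      simp
    rw [e1, e2, map_zero, add_zero] at t
    refine t.trans ?_
    simp only [ContinuousLinearMap.id_apply]
    rw [← laplacian_eq_sum_fderiv_fderiv _ v]
    have t2 := (contDiffAt_const (c := A) (x := x - c)).laplacian_add
      (ContDiffAt.const_smul B (contDiffAt_norm_rpow (hne x hx) (-(m : ℝ))))
    have t3 := laplacian_smul B (contDiffAt_norm_rpow (hne x hx) (-(m : ℝ)))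
    rw [laplacian_norm_rpow (hne x hx), hd] at t3
    refine t2.trans ?_
    erw [t3]
    rw [laplacian_const]
    push_cast
    simp
  intro x hx1 hx2
  have main := nonneg_of_laplacian_neg (K := K) (S := {x | ‖x - c‖ = r₁ ∨ ‖x - c‖ = r₂})
    (f := fun x => f x - h x) hKc ?_ ?_ ?_ x ⟨hx1, hx2⟩
  · rw [← hval]
    linarith
  · intro z hz
    refine ContinuousAt.continuousWithinAt ?_
    exact (hcont z hz.1 hz.2).sub (hhC z hz).continuousAt
  · rintro z (hz | hz)
    · rw [hval, hz]
      linarith [h₁ z hz]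
    · rw [hval, hz]
      linarith [h₂ z hz]
  · intro z hz hzS
    simp only [Set.mem_ofPred_eq, not_or] at hzS
    have hz1 : r₁ < ‖z - c‖ := lt_of_le_of_ne hz.1 (Ne.symm hzS.1)
    have hz2 : ‖z - c‖ < r₂ := lt_of_le_of_ne hz.2 hzS.2
    obtain ⟨hc, hl⟩ := hf z hz1 hz2
    refine ⟨?_, hc.sub (hhC z hz), ?_⟩
    · filter_upwards [(isOpen_lt continuous_const (continuous_id.sub continuous_const).norm).mem_nhds
        (show r₁ < ‖id z - c‖ from hz1),
        (isOpen_lt (continuous_id.sub continuous_const).norm continuous_const).mem_nhds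
        (show ‖id z - c‖ < r₂ from hz2)] with y hy1 hy2
      exact ⟨le_of_lt hy1, le_of_lt hy2⟩
    · have := hc.laplacian_sub (hhC z hz)
      rw [hhL z hz, sub_zero] at this
      exact this.trans_lt hl

end MinimumPrinciple

section MovingSpheres

variable {E : Type*} [NormedAddCommGroup E] [InnerProductSpace ℝ E]

lemma norm_sphere_inversion {l : ℝ} {y : E} (hy : y ≠ 0) :
    ‖(l / ‖y‖) ^ 2 • y‖ = l ^ 2 / ‖y‖ := by
  have := norm_pos_iff.2 hy
  rw [norm_smul, Real.norm_of_nonneg (by positivity)]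
  field_simp

lemma sphere_inversion_ne {l : ℝ} {q y : E} (hl : 0 ≤ l) (hq : l < ‖q‖) (hy : l < ‖y‖) :
    (l / ‖y‖) ^ 2 • y ≠ q := by
  intro h
  have hy0 : 0 < ‖y‖ := hl.trans_lt hy
  have h1 := norm_sphere_inversion (l := l) (norm_pos_iff.1 hy0)
  rw [h, eq_div_iff hy0.ne'] at h1
  nlinarith

lemma mul_norm_sub_le_norm_sphere_inversion_sub {l : ℝ} {q y : E} (hl : 0 ≤ l) (hq : l < ‖q‖)
    (hy : l < ‖y‖) :
    l / ‖y‖ * ‖y - q‖ ≤ ‖(l / ‖y‖) ^ 2 • y - q‖ := by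
  have hy0 : 0 < ‖y‖ := hl.trans_lt hy
  set t := l / ‖y‖ with ht
  have ht0 : 0 ≤ t := by positivity
  have ht1 : t ≤ 1 := by rw [ht, div_le_one hy0]; exact hy.le
  have hty : t * ‖y‖ = l := by rw [ht]; field_simp
  refine (sq_le_sq₀ (by positivity) (norm_nonneg _)).1 ?_
  rw [mul_pow, norm_sub_sq_real, norm_sub_sq_real, norm_smul, inner_smul_left,
    Real.norm_of_nonneg (by positivity)]
  simp only [conj_trivial]
  have h : 0 ≤ (1 - t ^ 2) * (‖q‖ ^ 2 - (t * ‖y‖) ^ 2) := by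
    refine mul_nonneg (by nlinarith) ?_
    rw [hty]
    nlinarith
  nlinarith

variable [FiniteDimensional ℝ E]

/-- A positive strictly superharmonic function outside a ball, with a possible singularity at `q`,
decays at most like the fundamental solution. -/
lemma exists_lower_bound_of_superharmonic {m : ℕ} (hd : Module.finrank ℝ E = m + 2) (hm : m ≠ 0)
    {q : E} {r : ℝ} (hr : 0 < r) (hrq : r < ‖q‖) {f : E → ℝ}
    (hf : ∀ y, r ≤ ‖y‖ → y ≠ q → ContDiffAt ℝ 2 f y ∧ Laplacian.laplacian f y < 0 ∧ 0 < f y) :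
    ∃ c > 0, ∀ y, r ≤ ‖y‖ → y ≠ q → c ≤ ‖y‖ ^ m * f y := by
  have hcompact : ∀ K : Set E, IsCompact K → (∀ y ∈ K, r ≤ ‖y‖ ∧ y ≠ q) →
      ∃ c > 0, ∀ y ∈ K, c ≤ f y := by
    intro K hK hKr
    obtain ⟨c, hc, hc'⟩ := hK.exists_forall_le' (f := f) (a := 0)
      (fun y hy => (hf y (hKr y hy).1 (hKr y hy).2).1.continuousAt.continuousWithinAt)
      (fun y hy => (hf y (hKr y hy).1 (hKr y hy).2).2.2)
    exact ⟨c, hc, hc'⟩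
  set ρ : ℝ := (‖q‖ - r) / 2 with hρ
  have hρ0 : 0 < ρ := by linarith
  have hball : ∀ y, ‖y - q‖ ≤ ρ → r ≤ ‖y‖ := by
    intro y hy
    have := norm_sub_norm_le q y
    rw [norm_sub_rev] at this
    linarith
  set R : ℝ := ‖q‖ + 1 with hR
  have hR0 : 0 < R := by positivity
  have hout : ∀ y, R ≤ ‖y‖ → r ≤ ‖y‖ ∧ y ≠ q := by
    intro y hy
    refine ⟨by linarith, ?_⟩
    rintro rfl
    linarith
  obtain ⟨c₁, hc₁, h₁⟩ := hcompact (Metric.sphere q ρ) (isCompact_sphere q ρ) (by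
    intro y hy
    rw [mem_sphere_iff_norm] at hy
    refine ⟨hball y hy.le, ?_⟩
    rintro rfl
    simp at hy
    linarith)
  obtain ⟨c₂, hc₂, h₂⟩ := hcompact (Metric.sphere 0 R) (isCompact_sphere 0 R) (by
    intro y hy
    rw [mem_sphere_zero_iff_norm] at hy
    exact hout y hy.ge)
  obtain ⟨c₃, hc₃, h₃⟩ := hcompact ({y | r ≤ ‖y‖ ∧ ‖y‖ ≤ R ∧ ρ ≤ ‖y - q‖}) (by
      refine (isCompact_closedBall (0 : E) R).of_isClosed_subset ?_ ?_
      · exact (isClosed_le continuous_const continuous_norm).inter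
          ((isClosed_le continuous_norm continuous_const).inter
          (isClosed_le continuous_const (continuous_id.sub continuous_const).norm))
      · intro x hx
        simpa [dist_eq_norm] using hx.2.1) (by
    rintro y ⟨hy1, -, hy3⟩
    refine ⟨hy1, ?_⟩
    rintro rfl
    simp at hy3
    linarith)
  have hin : ∀ y, ‖y - q‖ ≤ ρ → y ≠ q → c₁ ≤ f y := by
    intro y hy hyq
    have hyq' : 0 < ‖y - q‖ := norm_pos_iff.2 (sub_ne_zero.2 hyq)
    have key : ∀ᶠ δ in 𝓝[>] (0 : ℝ), c₁ + (-(c₁ * δ ^ m)) * (‖y - q‖ ^ m)⁻¹ ≤ f y := by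
      filter_upwards [Ioo_mem_nhdsGT hyq'] with δ hδ
      have hne : ∀ x, δ ≤ ‖x - q‖ → x ≠ q := by
        rintro x hx rfl
        simp at hx
        linarith [hδ.1]
      refine le_of_laplacian_neg_annulus hd (r₁ := δ) (r₂ := ρ) hδ.1
        (fun x h1 h2 => (hf x (hball x h2) (hne x h1)).1.continuousAt)
        (fun x h1 h2 => ⟨(hf x (hball x h2.le) (hne x h1.le)).1,
          (hf x (hball x h2.le) (hne x h1.le)).2.1⟩) ?_ ?_ y hδ.2.le hy
      · intro x hx
        have h0 := (hf x (hball x (hx.le.trans (hδ.2.le.trans hy))) (hne x hx.ge)).2.2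
        have : c₁ + (-(c₁ * δ ^ m)) * (δ ^ m)⁻¹ = 0 := by
          have := (pow_pos hδ.1 m).ne'
          field_simp
          ring
        rw [this]
        exact h0.le
      · intro x hx
        refine le_trans ?_ (h₁ x (by rwa [mem_sphere_iff_norm]))
        have : 0 ≤ c₁ * δ ^ m * (ρ ^ m)⁻¹ := by
          have := hδ.1
          positivity
        linarith
    have hlim : Tendsto (fun δ : ℝ => c₁ + (-(c₁ * δ ^ m)) * (‖y - q‖ ^ m)⁻¹) (𝓝[>] 0)
        (𝓝 c₁) := by
      have : Continuous (fun δ : ℝ => c₁ + (-(c₁ * δ ^ m)) * (‖y - q‖ ^ m)⁻¹) := by fun_prop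
      exact (this.tendsto' 0 _ (by simp [hm])).mono_left nhdsWithin_le_nhds
    exact le_of_tendsto hlim key
  have hfar : ∀ y, R ≤ ‖y‖ → c₂ * R ^ m * (‖y‖ ^ m)⁻¹ ≤ f y := by
    intro y hy
    have key : ∀ᶠ S in atTop, -(c₂ * R ^ m * (S ^ m)⁻¹) + c₂ * R ^ m * (‖y‖ ^ m)⁻¹ ≤ f y := by
      filter_upwards [eventually_ge_atTop ‖y‖] with S hS
      have := le_of_laplacian_neg_annulus hd (c := 0) (r₁ := R) (r₂ := S) (f := f)
        (A := -(c₂ * R ^ m * (S ^ m)⁻¹)) (B := c₂ * R ^ m) hR0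
        (fun x h1 h2 => (hf x (hout x (by simpa using h1)).1
          (hout x (by simpa using h1)).2).1.continuousAt)
        (fun x h1 h2 => ⟨(hf x (hout x (by simpa using h1.le)).1
          (hout x (by simpa using h1.le)).2).1, (hf x (hout x (by simpa using h1.le)).1
          (hout x (by simpa using h1.le)).2).2.1⟩) ?_ ?_ y (by simpa using hy) (by simpa using hS)
      · simpa using this
      · intro x hx
        rw [sub_zero] at hx
        refine le_trans ?_ (h₂ x (by rwa [mem_sphere_zero_iff_norm]))
        have h0 : 0 ≤ c₂ * R ^ m * (S ^ m)⁻¹ := by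
          have : 0 < S := by linarith
          positivity
        have h1 : c₂ * R ^ m * (R ^ m)⁻¹ = c₂ := by field_simp
        linarith
      · intro x hx
        rw [sub_zero] at hx
        have h0 := (hf x (hout x (by linarith)).1 (hout x (by linarith)).2).2.2
        linarith
    have hlim : Tendsto (fun S : ℝ => -(c₂ * R ^ m * (S ^ m)⁻¹) + c₂ * R ^ m * (‖y‖ ^ m)⁻¹) atTop
        (𝓝 (c₂ * R ^ m * (‖y‖ ^ m)⁻¹)) := by
      have h := (tendsto_pow_atTop (α := ℝ) hm).inv_tendsto_atTop
      have h2 := ((h.const_mul (c₂ * R ^ m)).neg).add_const (c₂ * R ^ m * (‖y‖ ^ m)⁻¹)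
      simpa using h2
    exact le_of_tendsto hlim key
  refine ⟨min (min (r ^ m * c₁) (r ^ m * c₃)) (c₂ * R ^ m), by positivity, fun y hy hyq => ?_⟩
  have hy0 : 0 < ‖y‖ := hr.trans_le hy
  have hpow : r ^ m ≤ ‖y‖ ^ m := pow_le_pow_left₀ hr.le hy m
  by_cases h1 : ‖y - q‖ ≤ ρ
  · refine (min_le_left _ _).trans ((min_le_left _ _).trans ?_)
    exact mul_le_mul hpow (hin y h1 hyq) hc₁.le (by positivity)
  · by_cases h2 : R ≤ ‖y‖
    · refine (min_le_right _ _).trans ?_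
      have := mul_le_mul_of_nonneg_left (hfar y h2) (pow_pos hy0 m).le
      refine le_trans (le_of_eq ?_) this
      field_simp
    · refine (min_le_left _ _).trans ((min_le_right _ _).trans ?_)
      exact mul_le_mul hpow (h₃ y ⟨hy, (not_le.1 h2).le, (not_le.1 h1).le⟩) hc₃.le (by positivity)

end MovingSpheres

section MovingSpheres

/-- The structural condition on a nonlinearity that makes the moving spheres method work:
positivity and strict subcriticality under Kelvin transforms. -/
structure KelvinSubcritical {ι : Type*} (m : ℕ) (G : ι → ℝ → (ι → ℝ) → ℝ) : Prop where
  pos : ∀ i ρ z, 0 < ρ → (∀ j, 0 < z j) → 0 < G i ρ z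
  scale : ∀ i τ ρ σ z z', 0 < τ → τ < 1 → 0 < ρ → τ * ρ ≤ σ → (∀ j, 0 < z j) →
    (∀ j, τ ^ m * z j ≤ z' j) → τ ^ (m + 4) * G i σ z < G i ρ z'

variable {E : Type*} [NormedAddCommGroup E] [InnerProductSpace ℝ E]

lemma kelvin_zero {m : ℕ} (hm : m ≠ 0) (f : E → ℝ) : kelvin m 0 f = fun _ => 0 := by
  funext y
  simp [kelvin, hm]

variable [FiniteDimensional ℝ E]

/-- A positive classical solution of `-Δ wᵢ = Gᵢ(|y - q|, w)` away from the point `q`. -/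
structure IsSingularSolution {ι : Type*} (q : E) (G : ι → ℝ → (ι → ℝ) → ℝ) (w : ι → E → ℝ) :
    Prop where
  contDiffAt : ∀ i y, y ≠ q → ContDiffAt ℝ 2 (w i) y
  pos : ∀ i y, y ≠ q → 0 < w i y
  laplacian_eq : ∀ i y, y ≠ q → -Laplacian.laplacian (w i) y = G i ‖y - q‖ (fun j => w j y)

/-- The sphere of radius `l` about the origin is admissible for the moving spheres method. -/
def SphereAdmissible {ι : Type*} (m : ℕ) (q : E) (w : ι → E → ℝ) (l : ℝ) : Prop :=
  ∀ i y, l < ‖y‖ → y ≠ q → kelvin m l (w i) y ≤ w i y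

variable {ι : Type*} {m : ℕ} {q : E} {G : ι → ℝ → (ι → ℝ) → ℝ} {w : ι → E → ℝ}

lemma IsSingularSolution.sub_kelvin (hd : Module.finrank ℝ E = m + 2) (hm : m ≠ 0)
    (hG : KelvinSubcritical m G) (hw : IsSingularSolution q G w) {l : ℝ} (hl : 0 ≤ l)
    (hlq : l < ‖q‖) (hP : SphereAdmissible m q w l) (i : ι) {y : E} (hy : l < ‖y‖) (hyq : y ≠ q) :
    ContDiffAt ℝ 2 (w i - kelvin m l (w i)) y ∧
      Laplacian.laplacian (w i - kelvin m l (w i)) y < 0 ∧ 0 < (w i - kelvin m l (w i)) y := by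
  have hsub : 0 < ‖y - q‖ := norm_pos_iff.2 (sub_ne_zero.2 hyq)
  rcases hl.eq_or_lt with rfl | hl
  · rw [kelvin_zero hm]
    have e : (w i - fun _ => (0 : ℝ)) = w i := by
      funext x
      simp
    rw [e]
    refine ⟨hw.contDiffAt i y hyq, ?_, hw.pos i y hyq⟩
    have h1 := hw.laplacian_eq i y hyq
    have h2 := hG.pos i ‖y - q‖ (fun j => w j y) hsub (fun j => hw.pos j y hyq)
    linarith
  have hmain : ∀ y, l < ‖y‖ → y ≠ q → ContDiffAt ℝ 2 (w i - kelvin m l (w i)) y ∧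
      Laplacian.laplacian (w i - kelvin m l (w i)) y < 0 := by
    intro y hy hyq
    have hsub : 0 < ‖y - q‖ := norm_pos_iff.2 (sub_ne_zero.2 hyq)
    have hy0 : 0 < ‖y‖ := hl.trans hy
    have hy0' : y ≠ 0 := norm_pos_iff.1 hy0
    have hne := sphere_inversion_ne hl.le hlq hy
    have hk := contDiffAt_kelvin (m := m) hy0' (hw.contDiffAt i _ hne)
    refine ⟨(hw.contDiffAt i y hyq).sub hk, ?_⟩
    rw [(hw.contDiffAt i y hyq).laplacian_sub hk,
      laplacian_kelvin hd hy0' (hw.contDiffAt i _ hne)]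
    have h1 := hw.laplacian_eq i y hyq
    have h2 := hw.laplacian_eq i _ hne
    have h3 := hG.scale i (l / ‖y‖) ‖y - q‖ ‖(l / ‖y‖) ^ 2 • y - q‖
      (fun j => w j ((l / ‖y‖) ^ 2 • y)) (fun j => w j y) (by positivity)
      ((div_lt_one hy0).2 hy) hsub (mul_norm_sub_le_norm_sphere_inversion_sub hl.le hlq hy)
      (fun j => hw.pos j _ hne) (fun j => hP j y hy hyq)
    rw [← h1, ← h2] at h3
    linarith
  obtain ⟨h1, h2⟩ := hmain y hy hyq
  refine ⟨h1, h2, lt_of_le_of_ne (sub_nonneg.2 (hP i y hy hyq)) fun h0 => ?_⟩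
  refine absurd (IsLocalMin.laplacian_nonneg h1 ?_) (not_le.2 h2)
  have hopen : IsOpen {x : E | l < ‖x‖ ∧ x ≠ q} :=
    (isOpen_lt continuous_const continuous_norm).inter isOpen_ne
  filter_upwards [hopen.mem_nhds ⟨hy, hyq⟩] with x hx
  rw [← h0]
  exact sub_nonneg.2 (hP i x hx.1 hx.2)

lemma HasDerivAt.nonneg_of_eventually_nonneg {f : ℝ → ℝ} {f' x : ℝ} (hf : HasDerivAt f f' x)
    (h0 : f x = 0) (h : ∀ᶠ t in 𝓝[>] x, 0 ≤ f t) : 0 ≤ f' := by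
  have h1 : Tendsto (slope f x) (𝓝[>] x) (𝓝 f') := (hasDerivAt_iff_tendsto_slope.1 hf).mono_left
    (nhdsWithin_mono x (fun y (hy : x < y) => hy.ne'))
  refine ge_of_tendsto h1 ?_
  filter_upwards [h, self_mem_nhdsWithin] with t ht htx
  rw [slope_def_field, h0, sub_zero]
  exact div_nonneg ht (sub_nonneg.2 (le_of_lt htx))

/-- Hopf's lemma on the reflecting sphere. -/
lemma IsSingularSolution.radial_deriv_pos (hd : Module.finrank ℝ E = m + 2) (hm : m ≠ 0)
    (hG : KelvinSubcritical m G) (hw : IsSingularSolution q G w) {l : ℝ} (hl : 0 ≤ l)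
    (hlq : l < ‖q‖) (hP : SphereAdmissible m q w l) (i : ι) {y : E} (hy : ‖y‖ = l) :
    0 < (m : ℝ) / 2 * w i y + fderiv ℝ (w i) y y := by
  have hm0 : (0 : ℝ) < m := by exact_mod_cast Nat.pos_of_ne_zero hm
  have hne : ∀ y : E, ‖y‖ < ‖q‖ → y ≠ q := by
    rintro y hy rfl
    exact lt_irrefl _ hy
  have hyq : y ≠ q := hne y (hy ▸ hlq)
  rcases hl.eq_or_lt with rfl | hl
  · have : y = 0 := norm_eq_zero.1 hy
    subst this
    have := hw.pos i 0 hyq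
    simp only [map_zero, add_zero]
    positivity
  have hφ := fun x h1 h2 => hw.sub_kelvin hd hm hG hl.le hlq hP i (y := x) h1 h2
  set r : ℝ := (l + ‖q‖) / 2 with hr
  have hlr : l < r := by linarith
  have hrq : r < ‖q‖ := by linarith
  obtain ⟨c, hc, hc'⟩ := (isCompact_sphere (0 : E) r).exists_forall_le'
    (f := w i - kelvin m l (w i)) (a := 0)
    (fun x hx => by
      rw [mem_sphere_zero_iff_norm] at hx
      exact (hφ x (by linarith) (hne x (by linarith))).1.continuousAt.continuousWithinAt)
    (fun x hx => by
      rw [mem_sphere_zero_iff_norm] at hx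
      exact (hφ x (by linarith) (hne x (by linarith))).2.2)
  have hbound : ∀ x : E, l ≤ ‖x‖ → ‖x‖ ≤ r →
      c + -(c * l ^ m) * (‖x‖ ^ m)⁻¹ ≤ (w i - kelvin m l (w i)) x := by
    intro x hx1 hx2
    have := le_of_laplacian_neg_annulus hd (c := 0) (r₁ := l) (r₂ := r)
      (f := w i - kelvin m l (w i)) (A := c) (B := -(c * l ^ m)) hl
      (fun z h1 h2 => ?_)
      (fun z h1 h2 => by
        rw [sub_zero] at h1 h2
        have := hφ z h1 (hne z (by linarith))
        exact ⟨this.1, this.2.1⟩) ?_ ?_ x (by simpa using hx1) (by simpa using hx2)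
    · simpa using this
    · rw [sub_zero] at h1 h2
      have hz0 : z ≠ 0 := norm_pos_iff.1 (hl.trans_le h1)
      refine ((hw.contDiffAt i z (hne z (by linarith))).sub
        (contDiffAt_kelvin hz0 (hw.contDiffAt i _ (hne _ ?_)))).continuousAt
      rw [norm_sphere_inversion hz0, div_lt_iff₀ (hl.trans_le h1)]
      nlinarith
    · intro z hz
      rw [sub_zero] at hz
      have e1 : (w i - kelvin m l (w i)) z = 0 := by
        simp [kelvin, hz, hl.ne']
      have e2 : c + -(c * l ^ m) * (l ^ m)⁻¹ = 0 := by
        field_simp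
        ring
      rw [e1, e2]
    · intro z hz
      rw [sub_zero] at hz
      refine le_trans ?_ (hc' z (by rwa [mem_sphere_zero_iff_norm]))
      have : 0 ≤ c * l ^ m * (r ^ m)⁻¹ := by
        have : 0 < r := hl.trans hlr
        positivity
      linarith
  have hcurve : HasDerivAt (fun t : ℝ => w i (t • y)) (fderiv ℝ (w i) y y) 1 := by
    have h1 : HasDerivAt (fun t : ℝ => t • y) y 1 := by
      simpa using (hasDerivAt_id (1 : ℝ)).smul_const y
    have h2 : HasFDerivAt (w i) (fderiv ℝ (w i) y) ((1 : ℝ) • y) := by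
      rw [one_smul]
      exact ((hw.contDiffAt i y hyq).differentiableAt (by norm_num)).hasFDerivAt
    exact h2.comp_hasDerivAt 1 h1
  have hinv : HasDerivAt (fun t : ℝ => t⁻¹) (-1) 1 := by
    simpa using hasDerivAt_inv (one_ne_zero (α := ℝ))
  have hcurve' : HasDerivAt (fun t : ℝ => w i (t⁻¹ • y)) (fderiv ℝ (w i) y y * -1) 1 := by
    have h2 : HasDerivAt (fun t : ℝ => w i (t • y)) (fderiv ℝ (w i) y y) ((1 : ℝ)⁻¹) := by
      rwa [inv_one]
    exact h2.comp 1 hinv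
  have hpow : HasDerivAt (fun t : ℝ => t⁻¹ ^ m) (-m) 1 := by
    simpa using hinv.fun_pow m
  have hg := (hcurve.fun_sub (hpow.fun_mul hcurve')).fun_sub
    ((hpow.const_sub 1).const_mul c)
  have hnn := hg.nonneg_of_eventually_nonneg (by simp) ?_
  · simp only [inv_one, one_pow, one_smul] at hnn
    have : 0 < c * m := by positivity
    linarith
  · have h1 : (1 : ℝ) < r / l := (one_lt_div hl).2 hlr
    filter_upwards [Ioo_mem_nhdsGT h1] with t ht
    have ht0 : 0 < t := by linarith [ht.1]
    have hn : ‖t • y‖ = t * l := by rw [norm_smul, Real.norm_of_nonneg ht0.le, hy]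
    have h2 := hbound (t • y) (by rw [hn]; nlinarith [ht.1])
      (by rw [hn]; exact ((lt_div_iff₀ hl).1 ht.2).le)
    have e : l / (t * l) = t⁻¹ := by field_simp
    have e2 : (t⁻¹) ^ 2 * t = t⁻¹ := by field_simp
    simp only [Pi.sub_apply, kelvin, hn, e, smul_smul, e2] at h2
    have e3 : c * l ^ m * ((t * l) ^ m)⁻¹ = c * t⁻¹ ^ m := by
      rw [mul_pow, inv_pow]
      field_simp
    linarith

end MovingSpheres

section MovingSpheres

variable {E : Type*} [NormedAddCommGroup E] [InnerProductSpace ℝ E]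

lemma kelvin_le_of_radial_deriv_nonneg {m : ℕ} {l : ℝ} {f : E → ℝ} {y : E} (hl : 0 < l)
    (hy : l < ‖y‖)
    (hf : ∀ z : E, l ^ 2 / ‖y‖ ≤ ‖z‖ → ‖z‖ ≤ ‖y‖ → DifferentiableAt ℝ f z ∧
      0 ≤ (m : ℝ) / 2 * f z + fderiv ℝ f z z) :
    kelvin m l f y ≤ f y := by
  have hy0 : 0 < ‖y‖ := hl.trans hy
  set t := l / ‖y‖ with ht
  have ht0 : 0 < t := by positivity
  have ht1 : t < 1 := (div_lt_one hy0).2 hy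
  have hz : ∀ s ∈ Set.Icc t 1, l ^ 2 / ‖y‖ ≤ ‖s ^ 2 • y‖ ∧ ‖s ^ 2 • y‖ ≤ ‖y‖ := by
    intro s hs
    have hs0 : 0 < s := ht0.trans_le hs.1
    rw [norm_smul, Real.norm_of_nonneg (by positivity)]
    constructor
    · have : l ^ 2 / ‖y‖ = t ^ 2 * ‖y‖ := by rw [ht]; field_simp
      rw [this]
      gcongr
      exact hs.1
    · exact mul_le_of_le_one_left hy0.le (pow_le_one₀ hs0.le hs.2)
  have hder : ∀ s ∈ Set.Icc t 1, HasDerivAt (fun s : ℝ => s ^ m * f (s ^ 2 • y))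
      (m * s ^ (m - 1) * f (s ^ 2 • y) + s ^ m * fderiv ℝ f (s ^ 2 • y) ((2 * s) • y)) s := by
    intro s hs
    have h1 : HasDerivAt (fun s : ℝ => s ^ 2 • y) ((2 * s) • y) s := by
      simpa using (hasDerivAt_pow 2 s).smul_const y
    have h2 := (hf _ (hz s hs).1 (hz s hs).2).1.hasFDerivAt.comp_hasDerivAt s h1
    exact (hasDerivAt_pow m s).fun_mul h2
  have hmono : MonotoneOn (fun s : ℝ => s ^ m * f (s ^ 2 • y)) (Set.Icc t 1) := by
    refine monotoneOn_of_hasDerivWithinAt_nonneg (convex_Icc t 1)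
      (fun s hs => (hder s hs).continuousAt.continuousWithinAt)
      (fun s hs => (hder s (interior_subset hs)).hasDerivWithinAt) fun s hs => ?_
    have hs := interior_subset hs
    have hs0 : 0 < s := ht0.trans_le hs.1
    have h3 := (hf _ (hz s hs).1 (hz s hs).2).2
    have e : s * (m * s ^ (m - 1) * f (s ^ 2 • y) +
        s ^ m * fderiv ℝ f (s ^ 2 • y) ((2 * s) • y))
        = 2 * s ^ m * ((m : ℝ) / 2 * f (s ^ 2 • y) + fderiv ℝ f (s ^ 2 • y) (s ^ 2 • y)) := by
      rw [map_smul, map_smul, smul_eq_mul, smul_eq_mul]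
      rcases Nat.eq_zero_or_pos m with rfl | hm
      · simp
        ring
      · obtain ⟨k, rfl⟩ := Nat.exists_eq_succ_of_ne_zero hm.ne'
        simp only [Nat.succ_sub_one, Nat.succ_eq_add_one]
        ring
    refine nonneg_of_mul_nonneg_right (a := s) ?_ hs0
    rw [e]
    positivity
  have := hmono ⟨le_rfl, ht1.le⟩ ⟨ht1.le, le_rfl⟩ ht1.le
  simpa [kelvin] using this

lemma norm_pow_mul_kelvin {m : ℕ} (l : ℝ) (f : E → ℝ) {y : E} (hy : y ≠ 0) :
    ‖y‖ ^ m * kelvin m l f y = l ^ m * f (l ^ 2 • ((‖y‖ ^ 2)⁻¹ • y)) := by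
  have := norm_pos_iff.2 hy
  rw [kelvin, smul_smul, div_pow, div_pow, div_eq_mul_inv (l ^ 2)]
  field_simp

variable [FiniteDimensional ℝ E]
variable {ι : Type*} {m : ℕ} {q : E} {G : ι → ℝ → (ι → ℝ) → ℝ} {w : ι → E → ℝ}

lemma IsSingularSolution.exists_shell (hd : Module.finrank ℝ E = m + 2) (hm : m ≠ 0)
    (hG : KelvinSubcritical m G) (hw : IsSingularSolution q G w) {l : ℝ} (hl : 0 ≤ l)
    (hlq : l < ‖q‖) (hP : SphereAdmissible m q w l) (i : ι) :
    ∃ η > 0, l + η < ‖q‖ ∧ ∀ z : E, l - η < ‖z‖ → ‖z‖ < l + η →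
      0 < (m : ℝ) / 2 * w i z + fderiv ℝ (w i) z z := by
  set r : ℝ := (l + ‖q‖) / 2 with hr
  have hne : ∀ y : E, ‖y‖ ≤ r → y ≠ q := by
    rintro y hy rfl
    linarith
  set N : E → ℝ := fun z => (m : ℝ) / 2 * w i z + fderiv ℝ (w i) z z with hN
  have hNc : ContinuousOn N (Metric.closedBall 0 r) := by
    intro z hz
    rw [mem_closedBall_zero_iff] at hz
    have h := hw.contDiffAt i z (hne z hz)
    exact ((h.continuousAt.const_mul _).add
      (h.differentiableAt_fderiv.continuousAt.clm_apply continuousAt_id)).continuousWithinAt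
  set C : Set E := Metric.closedBall 0 r ∩ N ⁻¹' Set.Iic 0 with hC
  have hCc : IsCompact C := (isCompact_closedBall 0 r).of_isClosed_subset
    (hNc.preimage_isClosed_of_isClosed Metric.isClosed_closedBall isClosed_Iic)
    Set.inter_subset_left
  obtain ⟨η, hη, hη'⟩ := hCc.exists_forall_le' (f := fun z : E => |‖z‖ - l|) (a := 0)
    (by fun_prop) (fun z hz => by
      refine abs_pos.2 (sub_ne_zero.2 fun h => ?_)
      have h1 := hw.radial_deriv_pos hd hm hG hl hlq hP i h
      have h2 : N z ≤ 0 := hz.2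
      exact absurd h1 (not_lt.2 h2))
  refine ⟨min η ((‖q‖ - l) / 2), lt_min hη (by linarith), ?_, ?_⟩
  · have := min_le_right η ((‖q‖ - l) / 2)
    linarith
  · intro z hz1 hz2
    have h1 := min_le_right η ((‖q‖ - l) / 2)
    have h2 := min_le_left η ((‖q‖ - l) / 2)
    by_contra h
    have hzC : z ∈ C := ⟨by rw [mem_closedBall_zero_iff]; linarith, not_lt.1 h⟩
    have h3 := hη' z hzC
    have h4 : |‖z‖ - l| < η := abs_lt.2 ⟨by linarith, by linarith⟩
    linarith

lemma IsSingularSolution.eventually_admissible (hd : Module.finrank ℝ E = m + 2) (hm : m ≠ 0)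
    (hG : KelvinSubcritical m G) (hw : IsSingularSolution q G w) {l : ℝ} (hl : 0 ≤ l)
    (hlq : l < ‖q‖) (hP : SphereAdmissible m q w l) (i : ι) :
    ∀ᶠ l' in 𝓝[>] l, ∀ y, l' < ‖y‖ → y ≠ q → kelvin m l' (w i) y ≤ w i y := by
  obtain ⟨η, hη, hηq, hN⟩ := hw.exists_shell hd hm hG hl hlq hP i
  have hr0 : 0 < l + η / 2 := by linarith
  obtain ⟨c, hc, hc'⟩ := exists_lower_bound_of_superharmonic hd hm hr0 (q := q) (by linarith)
    (f := w i - kelvin m l (w i))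
    (fun y hy hyq => hw.sub_kelvin hd hm hG hl hlq hP i (by linarith) hyq)
  have hfar : ∀ᶠ l' in 𝓝 l, ∀ z ∈ Metric.closedBall (0 : E) (l + η / 2)⁻¹,
      l' ^ m * w i (l' ^ 2 • z) - l ^ m * w i (l ^ 2 • z) < c := by
    refine (isCompact_closedBall (0 : E) _).eventually_forall_of_forall_eventually fun z hz => ?_
    rw [mem_closedBall_zero_iff] at hz
    have hne : l ^ 2 • z ≠ q := by
      intro h
      have h1 : ‖l ^ 2 • z‖ ≤ l := by
        rw [norm_smul, Real.norm_of_nonneg (by positivity)]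
        calc l ^ 2 * ‖z‖ ≤ l ^ 2 * (l + η / 2)⁻¹ := by gcongr
          _ ≤ l := by
            rw [← div_eq_mul_inv, div_le_iff₀ hr0]
            nlinarith
      rw [h] at h1
      linarith
    have hwc := (hw.contDiffAt i _ hne).continuousAt
    have h1 : ContinuousAt (fun x : ℝ × E => x.1 ^ m * w i (x.1 ^ 2 • x.2)
        - l ^ m * w i (l ^ 2 • x.2)) (l, z) := by
      refine ContinuousAt.sub (ContinuousAt.mul (by fun_prop) ?_)
        (ContinuousAt.mul continuousAt_const ?_)
      · exact ContinuousAt.comp (f := fun x : ℝ × E => x.1 ^ 2 • x.2) (g := w i) hwc (by fun_prop)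
      · exact ContinuousAt.comp (f := fun x : ℝ × E => l ^ 2 • x.2) (g := w i) hwc (by fun_prop)
    have h2 := h1.eventually_lt (continuousAt_const (y := c)) (by simpa using hc)
    exact h2
  filter_upwards [hfar.filter_mono nhdsWithin_le_nhds, self_mem_nhdsWithin] with l' h1 h2 y hy hyq
  replace h2 : l < l' := h2
  have hl' : 0 < l' := hl.trans_lt h2
  have hy0 : 0 < ‖y‖ := hl'.trans hy
  rcases lt_or_ge ‖y‖ (l + η / 2) with h3 | h3
  · refine kelvin_le_of_radial_deriv_nonneg hl' hy fun z hz1 hz2 => ⟨?_, ?_⟩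
    · refine (hw.contDiffAt i z ?_).differentiableAt (by norm_num)
      rintro rfl
      linarith
    · refine (hN z (lt_of_lt_of_le ?_ hz1) (by linarith)).le
      rw [lt_div_iff₀ hy0]
      rcases le_or_gt (l - η) 0 with h | h <;> nlinarith
  · have h4 := hc' y h3 hyq
    have h5 := h1 ((‖y‖ ^ 2)⁻¹ • y) (by
      rw [mem_closedBall_zero_iff, norm_smul, norm_inv, norm_pow, norm_norm]
      have : (‖y‖ ^ 2)⁻¹ * ‖y‖ = ‖y‖⁻¹ := by field_simp
      rw [this]
      gcongr)
    rw [← norm_pow_mul_kelvin l' _ (norm_pos_iff.1 hy0),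
      ← norm_pow_mul_kelvin l _ (norm_pos_iff.1 hy0)] at h5
    rw [Pi.sub_apply, mul_sub] at h4
    have h6 : ‖y‖ ^ m * kelvin m l' (w i) y ≤ ‖y‖ ^ m * w i y := by linarith
    exact le_of_mul_le_mul_left h6 (by positivity)

/-- Moving spheres: every sphere about the origin that does not enclose the singularity is
admissible. -/
theorem IsSingularSolution.sphereAdmissible [Finite ι] (hd : Module.finrank ℝ E = m + 2)
    (hm : m ≠ 0) (hG : KelvinSubcritical m G) (hw : IsSingularSolution q G w) {l : ℝ} (hl : 0 ≤ l)
    (hlq : l < ‖q‖) : SphereAdmissible m q w l := by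
  have hclosed : IsClosed ({l | SphereAdmissible m q w l} ∩ Set.Icc 0 l) := by
    refine isClosed_of_closure_subset fun l₀ hl₀ => ?_
    have hmem : l₀ ∈ Set.Icc 0 l :=
      closure_minimal Set.inter_subset_right isClosed_Icc hl₀
    refine ⟨fun i y hy hyq => ?_, hmem⟩
    by_contra! hcon
    have hy0 : 0 < ‖y‖ := hmem.1.trans_lt hy
    have hwc := (hw.contDiffAt i _
      (sphere_inversion_ne hmem.1 (hmem.2.trans_lt hlq) hy)).continuousAt
    have hcont : ContinuousAt (fun t : ℝ => kelvin m t (w i) y) l₀ := by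
      refine ContinuousAt.mul (by fun_prop) ?_
      exact ContinuousAt.comp (f := fun t : ℝ => (t / ‖y‖) ^ 2 • y) (g := w i) hwc (by fun_prop)
    have h1 := (continuousAt_const (y := w i y)).eventually_lt hcont hcon
    obtain ⟨t, ⟨ht3, -⟩, ht1, ht2⟩ :=
      ((mem_closure_iff_frequently.1 hl₀).and_eventually (h1.and (gt_mem_nhds hy))).exists
    exact absurd (ht3 i y ht2 hyq) (not_le.2 ht1)
  have h := hclosed.Icc_subset_of_forall_exists_gt (fun i y hy hyq => ?_) fun l₀ hl₀ t ht => ?_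
  · exact h ⟨hl, le_rfl⟩
  · rw [kelvin_zero hm]
    exact (hw.pos i y hyq).le
  · have h1 : ∀ᶠ l' in 𝓝[>] l₀, SphereAdmissible m q w l' :=
      eventually_all.2 fun i =>
        hw.eventually_admissible hd hm hG hl₀.2.1 (hl₀.2.2.trans hlq) hl₀.1 i
    obtain ⟨l', hl'⟩ := (h1.and (Ioc_mem_nhdsGT ht)).exists
    exact ⟨l', hl'⟩

end MovingSpheres

section RadialSymmetry

variable {E : Type*} [NormedAddCommGroup E] [InnerProductSpace ℝ E] [FiniteDimensional ℝ E]

lemma laplacian_comp_add_right (f : E → ℝ) (a x : E) :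
    Laplacian.laplacian (fun y => f (y + a)) x = Laplacian.laplacian f (x + a) := by
  rw [laplacian_eq_sum_fderiv_fderiv _ (stdOrthonormalBasis ℝ E),
    laplacian_eq_sum_fderiv_fderiv _ (stdOrthonormalBasis ℝ E)]
  have h : fderiv ℝ (fun y => f (y + a)) = fun y => fderiv ℝ f (y + a) := by
    funext y
    exact fderiv_comp_add_right a
  rw [h, fderiv_comp_add_right a]

variable {ι : Type*} {m : ℕ} {G : ι → ℝ → (ι → ℝ) → ℝ} {w : ι → E → ℝ}

lemma IsSingularSolution.comp_add_right (hw : IsSingularSolution (0 : E) G w) (a : E) :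
    IsSingularSolution (-a) G (fun i y => w i (y + a)) where
  contDiffAt i y hy := by
    have h := hw.contDiffAt i (y + a) fun h => hy (eq_neg_of_add_eq_zero_left h)
    exact ContDiffAt.comp (f := fun y => y + a) (g := w i) y h (by fun_prop)
  pos i y hy := hw.pos i (y + a) fun h => hy (eq_neg_of_add_eq_zero_left h)
  laplacian_eq i y hy := by
    rw [laplacian_comp_add_right,
      hw.laplacian_eq i (y + a) fun h => hy (eq_neg_of_add_eq_zero_left h)]
    simp

lemma IsSingularSolution.reflection_le [Finite ι] (hd : Module.finrank ℝ E = m + 2)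
    (hm : m ≠ 0) (hG : KelvinSubcritical m G) (hw : IsSingularSolution (0 : E) G w) (i : ι)
    {z e : E} (he : ‖e‖ = 1) (hz : ⟪z, e⟫_ℝ < 0) :
    w i (z - (2 * ⟪z, e⟫_ℝ) • e) ≤ w i z := by
  set c := ⟪z, e⟫_ℝ with hc
  have hz0 : z ≠ 0 := by
    rintro rfl
    simp at hc
    linarith
  set D : ℝ → ℝ := fun ε => 1 - 2 * ε * c + ε ^ 2 * ‖z‖ ^ 2 with hD
  set S : ℝ → ℝ := fun ε => (1 - ε ^ 2) / D ε with hS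
  set T : ℝ → ℝ := fun ε => (-2 * c + ε * (‖z‖ ^ 2 + 1)) / D ε with hT
  have hD0 : D 0 = 1 := by simp [hD]
  have hSc : ContinuousAt S 0 := by
    refine ContinuousAt.div (by fun_prop) (by fun_prop) (by simp [hD0])
  have hTc : ContinuousAt T 0 := by
    refine ContinuousAt.div (by fun_prop) (by fun_prop) (by simp [hD0])
  have hS0 : S 0 = 1 := by simp [hS, hD0]
  have hT0 : T 0 = -(2 * c) := by simp [hT, hD0]
  have hpt : S 0 • z + T 0 • e = z - (2 * c) • e := by
    rw [hS0, hT0, one_smul, neg_smul, sub_eq_add_neg]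
  have hnorm : ‖z - (2 * c) • e‖ ^ 2 = ‖z‖ ^ 2 := by
    rw [norm_sub_sq_real, inner_smul_right, ← hc, norm_smul, he, mul_one, Real.norm_eq_abs, sq_abs]
    ring
  have hne : z - (2 * c) • e ≠ 0 := by
    intro h
    rw [h] at hnorm
    exact hz0 (by simpa using hnorm.symm)
  have hlim : Tendsto (fun ε => √(S ε) ^ m * w i (S ε • z + T ε • e)) (𝓝[>] 0)
      (𝓝 (w i (z - (2 * c) • e))) := by
    have h1 : ContinuousAt (fun ε => √(S ε) ^ m * w i (S ε • z + T ε • e)) 0 := by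
      refine ContinuousAt.mul (hSc.sqrt.pow m) ?_
      refine ContinuousAt.comp (f := fun ε => S ε • z + T ε • e) (g := w i) ?_
        ((hSc.smul continuousAt_const).add (hTc.smul continuousAt_const))
      rw [hpt]
      exact (hw.contDiffAt i _ hne).continuousAt
    have h2 := h1.tendsto
    simp only [hpt] at h2
    rw [hS0] at h2
    simp only [Real.sqrt_one, one_pow, one_mul] at h2
    exact h2.mono_left nhdsWithin_le_nhds
  refine le_of_tendsto hlim ?_
  filter_upwards [Ioo_mem_nhdsGT (zero_lt_one' ℝ)] with ε hε
  have hε0 := hε.1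
  have hε2 : ε ^ 2 < 1 := by nlinarith [hε.2]
  have hDpos : 0 < D ε := by
    have : 0 < -(ε * c) := by nlinarith
    simp only [hD]
    nlinarith [sq_nonneg (ε * ‖z‖)]
  set y : E := z - ε⁻¹ • e with hy
  have hye : y + ε⁻¹ • e = z := by simp [hy]
  have hysq : ‖y‖ ^ 2 = D ε / ε ^ 2 := by
    rw [hy, norm_sub_sq_real, inner_smul_right, ← hc, norm_smul, he, mul_one, Real.norm_eq_abs,
      sq_abs]
    simp only [hD]
    field_simp
    ring
  set l : ℝ := √((1 - ε ^ 2) / ε ^ 2) with hl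
  have hlsq : l ^ 2 = (1 - ε ^ 2) / ε ^ 2 := Real.sq_sqrt (div_nonneg (by linarith) (by positivity))
  have hl0 : 0 ≤ l := Real.sqrt_nonneg _
  have hq : ‖-(ε⁻¹ • e)‖ = ε⁻¹ := by
    rw [norm_neg, norm_smul, he, mul_one, Real.norm_of_nonneg (by positivity)]
  have hratio : (l / ‖y‖) ^ 2 = S ε := by
    rw [div_pow, hlsq, hysq]
    simp only [hS]
    field_simp
  have hratio' : l / ‖y‖ = √(S ε) := by
    rw [← hratio, Real.sqrt_sq (by positivity)]
  have hlq : l < ‖-(ε⁻¹ • e)‖ := by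
    rw [hq]
    refine lt_of_pow_lt_pow_left₀ 2 (by positivity) ?_
    rw [hlsq, inv_pow, ← one_div]
    gcongr
    have : 0 < ε ^ 2 := by positivity
    linarith
  have hly : l < ‖y‖ := by
    refine lt_of_pow_lt_pow_left₀ 2 (by positivity) ?_
    rw [hlsq, hysq]
    gcongr
    simp only [hD]
    have : 0 < -(ε * c) := by nlinarith
    nlinarith [sq_nonneg (ε * ‖z‖), sq_nonneg ε]
  have hyq : y ≠ -(ε⁻¹ • e) := by
    intro h
    rw [h] at hye
    simp at hye
    exact hz0 hye.symm
  have := (hw.comp_add_right (ε⁻¹ • e)).sphereAdmissible hd hm hG hl0 hlq i y hly hyq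
  have himage : S ε • y + ε⁻¹ • e = S ε • z + T ε • e := by
    rw [hy, smul_sub, sub_add, smul_smul, ← sub_smul, sub_eq_add_neg, ← neg_smul]
    congr 2
    have hD1 := hDpos.ne'
    simp only [hT, hS]
    field_simp
    simp only [hD]
    ring
  simp only [kelvin, hye] at this
  rw [hratio, himage, hratio'] at this
  exact this

/-- Moving spheres with arbitrarily large radii yield radial symmetry about the singularity. -/
theorem IsSingularSolution.radial [Finite ι] (hd : Module.finrank ℝ E = m + 2)
    (hm : m ≠ 0) (hG : KelvinSubcritical m G) (hw : IsSingularSolution (0 : E) G w) (i : ι)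
    {x y : E} (hxy : ‖x‖ = ‖y‖) : w i x = w i y := by
  have key : ∀ x y : E, ‖x‖ = ‖y‖ → x ≠ y → w i x ≤ w i y := by
    intro x y hxy hne
    have hpos : 0 < ‖x - y‖ := norm_pos_iff.2 (sub_ne_zero.2 hne)
    have hin : ⟪y, x - y⟫_ℝ = -(‖x - y‖ ^ 2) / 2 := by
      rw [norm_sub_sq_real, inner_sub_right, real_inner_self_eq_norm_sq, hxy, real_inner_comm]
      ring
    have hin' : ⟪y, ‖x - y‖⁻¹ • (x - y)⟫_ℝ = -‖x - y‖ / 2 := by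
      rw [inner_smul_right, hin]
      field_simp
    have := hw.reflection_le hd hm hG i (z := y) (e := ‖x - y‖⁻¹ • (x - y))
      (by rw [norm_smul, norm_inv, norm_norm, inv_mul_cancel₀ hpos.ne'])
      (by rw [hin']; linarith)
    rw [hin', smul_smul] at this
    have e : 2 * (-‖x - y‖ / 2) * ‖x - y‖⁻¹ = -1 := by field_simp
    rwa [e, neg_one_smul, sub_neg_eq_add, add_sub_cancel] at this
  by_cases h : x = y
  · rw [h]
  · exact le_antisymm (key x y hxy h) (key y x hxy.symm (Ne.symm h))

end RadialSymmetry

section Coupling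

variable {ι : Type*} [Fintype ι]

/-- The coupling nonlinearity of the system. -/
def coupling (κ α β : ι → ι → ℝ) (i : ι) (z : ι → ℝ) : ℝ :=
  ∑ j, κ i j * z i ^ (α i j - 1) * z j ^ (β i j)

variable {κ α β : ι → ι → ℝ}

lemma coupling_pos (hκ : ∀ i j, 0 < κ i j) (i : ι) {z : ι → ℝ} (hz : ∀ j, 0 < z j) :
    0 < coupling κ α β i z :=
  Finset.sum_pos (fun j _ => mul_pos (mul_pos (hκ i j) (Real.rpow_pos_of_pos (hz i) _))
    (Real.rpow_pos_of_pos (hz j) _)) ⟨i, Finset.mem_univ i⟩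

lemma coupling_mono (hκ : ∀ i j, 0 < κ i j) (hα : ∀ i j, 1 < α i j) (hβ : ∀ i j, 1 < β i j)
    (i : ι) {z z' : ι → ℝ} (hz : ∀ j, 0 < z j) (hzz' : ∀ j, z j ≤ z' j) :
    coupling κ α β i z ≤ coupling κ α β i z' := by
  refine Finset.sum_le_sum fun j _ => ?_
  have h1 := Real.rpow_le_rpow (hz i).le (hzz' i) (sub_nonneg.2 (hα i j).le)
  have h2 := Real.rpow_le_rpow (hz j).le (hzz' j) (zero_le_one.trans (hβ i j).le)
  have h3 := (hκ i j).le
  have h4 := Real.rpow_nonneg (hz j).le (β i j)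
  have h5 := Real.rpow_nonneg ((hz i).le.trans (hzz' i)) (α i j - 1)
  exact mul_le_mul (mul_le_mul_of_nonneg_left h1 h3) h2 h4 (mul_nonneg h3 h5)

lemma coupling_smul {p : ℝ} (hαβ : ∀ i j, α i j + β i j = p) (i : ι) {t : ℝ} {z : ι → ℝ}
    (ht : 0 < t) (hz : ∀ j, 0 < z j) :
    coupling κ α β i (fun j => t * z j) = t ^ (p - 1) * coupling κ α β i z := by
  simp only [coupling, Finset.mul_sum]
  refine Finset.sum_congr rfl fun j _ => ?_
  rw [Real.mul_rpow ht.le (hz i).le, Real.mul_rpow ht.le (hz j).le,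
    show p - 1 = (α i j - 1) + β i j by rw [← hαβ i j]; ring, Real.rpow_add ht]
  ring

lemma kelvinSubcritical_coupling {m : ℕ} {p γ s : ℝ} (hκ : ∀ i j, 0 < κ i j)
    (hα : ∀ i j, 1 < α i j) (hβ : ∀ i j, 1 < β i j) (hαβ : ∀ i j, α i j + β i j = p)
    (hγ : 0 ≤ γ) (hs : 0 ≤ s) (hγs : 0 < γ ∨ 0 < s) (hmp : m * p + 2 * s = 2 * m + 4) :
    KelvinSubcritical m
      (fun i ρ (z : ι → ℝ) => γ * ρ ^ (-2 : ℝ) * z i + ρ ^ (-s) * coupling κ α β i z) where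
  pos i ρ z hρ hz := by
    have h1 := coupling_pos (α := α) (β := β) hκ i hz
    have h2 := hz i
    have h3 := Real.rpow_pos_of_pos hρ (-s)
    positivity
  scale i τ ρ σ z z' hτ hτ1 hρ hσ hz hzz' := by
    have hz' : ∀ j, 0 < z' j := fun j => (mul_pos (pow_pos hτ m) (hz j)).trans_le (hzz' j)
    have hF : (τ ^ m) ^ (p - 1) * coupling κ α β i z ≤ coupling κ α β i z' := by
      rw [← coupling_smul hαβ i (pow_pos hτ m) hz]
      exact coupling_mono hκ hα hβ i (fun j => mul_pos (pow_pos hτ m) (hz j)) hzz'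
    have hFz := coupling_pos (α := α) (β := β) hκ i hz
    have hFz' := coupling_pos (α := α) (β := β) hκ i hz'
    have hscale : ∀ t : ℝ, 0 ≤ t → σ ^ (-t) ≤ τ ^ (-t) * ρ ^ (-t) := by
      intro t ht
      rw [← Real.mul_rpow hτ.le hρ.le]
      exact Real.rpow_le_rpow_of_nonpos (by positivity) hσ (by linarith)
    have hρ2 := Real.rpow_pos_of_pos hρ (-2)
    have hρs := Real.rpow_pos_of_pos hρ (-s)
    have e1 : τ ^ (m + 4) * τ ^ (-2 : ℝ) = τ ^ 2 * τ ^ m := by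
      rw [Real.rpow_neg hτ.le, Real.rpow_two]
      field_simp
      ring
    have e2 : τ ^ (m + 4) * τ ^ (-s) = τ ^ s * (τ ^ m) ^ (p - 1) := by
      rw [← Real.rpow_natCast, ← Real.rpow_natCast, ← Real.rpow_mul hτ.le, ← Real.rpow_add hτ,
        ← Real.rpow_add hτ]
      congr 1
      push_cast
      linarith
    have h1 : τ ^ (m + 4) * (γ * σ ^ (-2 : ℝ) * z i) ≤ τ ^ 2 * (γ * ρ ^ (-2 : ℝ) * z' i) := by
      calc τ ^ (m + 4) * (γ * σ ^ (-2 : ℝ) * z i)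
          ≤ τ ^ (m + 4) * (γ * (τ ^ (-2 : ℝ) * ρ ^ (-2 : ℝ)) * z i) := by
            have := hscale 2 (by norm_num)
            have := (hz i).le
            gcongr
        _ = (τ ^ (m + 4) * τ ^ (-2 : ℝ)) * (γ * ρ ^ (-2 : ℝ) * z i) := by ring
        _ = τ ^ 2 * (γ * ρ ^ (-2 : ℝ)) * (τ ^ m * z i) := by rw [e1]; ring
        _ ≤ τ ^ 2 * (γ * ρ ^ (-2 : ℝ)) * z' i := by
            have := hzz' i
            gcongr
        _ = _ := by ring
    have h2 : τ ^ (m + 4) * (σ ^ (-s) * coupling κ α β i z)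
        ≤ τ ^ s * (ρ ^ (-s) * coupling κ α β i z') := by
      calc τ ^ (m + 4) * (σ ^ (-s) * coupling κ α β i z)
          ≤ τ ^ (m + 4) * ((τ ^ (-s) * ρ ^ (-s)) * coupling κ α β i z) := by
            have := hscale s hs
            gcongr
        _ = (τ ^ (m + 4) * τ ^ (-s)) * ρ ^ (-s) * coupling κ α β i z := by ring
        _ = τ ^ s * ρ ^ (-s) * ((τ ^ m) ^ (p - 1) * coupling κ α β i z) := by rw [e2]; ring
        _ ≤ τ ^ s * ρ ^ (-s) * coupling κ α β i z' := by gcongr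
        _ = _ := by ring
    have hτ2 : τ ^ 2 < 1 := pow_lt_one₀ hτ.le hτ1 (by norm_num)
    have hτs : τ ^ s ≤ 1 := Real.rpow_le_one hτ.le hτ1.le hs
    have hA : 0 ≤ γ * ρ ^ (-2 : ℝ) * z' i := by
      have := (hz' i).le
      positivity
    have hB : 0 < ρ ^ (-s) * coupling κ α β i z' := mul_pos hρs hFz'
    have h3 : τ ^ 2 * (γ * ρ ^ (-2 : ℝ) * z' i) + τ ^ s * (ρ ^ (-s) * coupling κ α β i z')
        < γ * ρ ^ (-2 : ℝ) * z' i + ρ ^ (-s) * coupling κ α β i z' := by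
      rcases hγs with h | h
      · have hA' : 0 < γ * ρ ^ (-2 : ℝ) * z' i := mul_pos (mul_pos h hρ2) (hz' i)
        have := mul_lt_mul_of_pos_right hτ2 hA'
        have := mul_le_mul_of_nonneg_right hτs hB.le
        linarith
      · have hτs' : τ ^ s < 1 := Real.rpow_lt_one hτ.le hτ1 h
        have := mul_le_mul_of_nonneg_right hτ2.le hA
        have := mul_lt_mul_of_pos_right hτs' hB
        linarith
    calc τ ^ (m + 4) * (γ * σ ^ (-2 : ℝ) * z i + σ ^ (-s) * coupling κ α β i z)
        = τ ^ (m + 4) * (γ * σ ^ (-2 : ℝ) * z i)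
          + τ ^ (m + 4) * (σ ^ (-s) * coupling κ α β i z) := by ring
      _ ≤ _ := add_le_add h1 h2
      _ < _ := h3

end Coupling

section Reduction

variable {n : ℕ}

lemma lapl_eq_laplacian {w : EuclideanSpace ℝ (Fin n) → ℝ} {x : EuclideanSpace ℝ (Fin n)}
    (hw : ContDiffAt ℝ 2 w x) : lapl w x = Laplacian.laplacian w x := by
  rw [laplacian_eq_sum_fderiv_fderiv w (EuclideanSpace.basisFun (Fin n) ℝ), lapl]
  refine Finset.sum_congr rfl fun i _ => ?_
  rw [(hw.hasFDerivAt_fderiv_apply _).fderiv, EuclideanSpace.basisFun_apply]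
  rfl

lemma laplacian_norm_rpow_mul {u : EuclideanSpace ℝ (Fin n) → ℝ} {x : EuclideanSpace ℝ (Fin n)}
    (a : ℝ) (hx : x ≠ 0) (hu : ContDiffAt ℝ 2 u x) :
    Laplacian.laplacian (fun y => ‖y‖ ^ (-a) * u y) x
      = ‖x‖ ^ a * wdiv a u x - a * (n - 2 - a) * ‖x‖ ^ (-2 : ℝ) * (‖x‖ ^ (-a) * u x) := by
  have hx' : 0 < ‖x‖ := norm_pos_iff.2 hx
  have h := laplacian_smul_fun (EuclideanSpace.basisFun (Fin n) ℝ) (contDiffAt_norm_rpow hx (-a)) hu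
  rw [laplacian_norm_rpow hx (-a)] at h
  have hsum : ∑ i, fderiv ℝ (fun y : EuclideanSpace ℝ (Fin n) => ‖y‖ ^ (-a)) x
      (EuclideanSpace.basisFun (Fin n) ℝ i) • fderiv ℝ u x (EuclideanSpace.basisFun (Fin n) ℝ i)
      = -a * ‖x‖ ^ (-a - 2) * ⟪x, gradient u x⟫_ℝ := by
    rw [(hasFDerivAt_norm_rpow' hx (-a)).fderiv]
    have e : ⟪x, gradient u x⟫_ℝ = fderiv ℝ u x x := by
      rw [real_inner_comm, gradient, InnerProductSpace.toDual_symm_apply]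
    rw [e]
    conv_rhs => rw [← (EuclideanSpace.basisFun (Fin n) ℝ).sum_repr' x, map_sum]
    rw [Finset.mul_sum]
    refine Finset.sum_congr rfl fun i _ => ?_
    rw [map_smul]
    simp only [smul_apply, innerSL_apply_apply, smul_eq_mul,
      (EuclideanSpace.basisFun (Fin n) ℝ).sum_repr' x]
    rw [real_inner_comm]
    ring
  rw [hsum] at h
  rw [wdiv, lapl_eq_laplacian hu]
  have e1 : ‖x‖ ^ (-a - 2) = ‖x‖ ^ (-a) * ‖x‖ ^ (-2 : ℝ) := by
    rw [← Real.rpow_add hx']; ring_nf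
  have e2 : ‖x‖ ^ a * ‖x‖ ^ (-(2 * a)) = ‖x‖ ^ (-a) := by
    rw [← Real.rpow_add hx']; ring_nf
  have e3 : (‖x‖ ^ 2)⁻¹ = ‖x‖ ^ (-2 : ℝ) := by
    rw [Real.rpow_neg hx'.le, Real.rpow_two]
  rw [← mul_assoc, e2, div_eq_mul_inv, e3]
  simp only [finrank_euclideanSpace, Fintype.card_fin, e1, smul_eq_mul] at h
  refine Eq.trans h ?_
  ring

end Reduction

section RadialODE

lemma abs_le_of_abs_hasDerivAt_le {f f' g g' : ℝ → ℝ} {R : ℝ}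
    (hf : ∀ r ∈ Set.Ioc 0 R, HasDerivAt f (f' r) r) (hg : ∀ r ∈ Set.Ioc 0 R, HasDerivAt g (g' r) r)
    (hfg : ∀ r ∈ Set.Ioc 0 R, |f' r| ≤ g' r) (hg0 : ∀ r ∈ Set.Ioc 0 R, 0 ≤ g r)
    (hf0 : Tendsto f (𝓝[>] 0) (𝓝 0)) {r : ℝ} (hr : r ∈ Set.Ioc 0 R) : |f r| ≤ g r := by
  have key : ∀ f f' : ℝ → ℝ, (∀ r ∈ Set.Ioc 0 R, HasDerivAt f (f' r) r) →
      (∀ r ∈ Set.Ioc 0 R, f' r ≤ g' r) → Tendsto f (𝓝[>] 0) (𝓝 0) → f r ≤ g r := by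
    intro f f' hf hfg hf0
    have hmono : MonotoneOn (fun t => g t - f t) (Set.Ioc 0 R) :=
      monotoneOn_of_hasDerivWithinAt_nonneg (convex_Ioc 0 R)
        (fun t ht => ((hg t ht).sub (hf t ht)).continuousAt.continuousWithinAt)
        (fun t ht => ((hg t (interior_subset ht)).sub
          (hf t (interior_subset ht))).hasDerivWithinAt)
        (fun t ht => sub_nonneg.2 (hfg t (interior_subset ht)))
    have h : 0 ≤ g r - f r := by
      refine le_of_tendsto (by simpa using hf0.neg) ?_
      filter_upwards [Ioo_mem_nhdsGT hr.1] with t ht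
      have h1 : t ∈ Set.Ioc 0 R := ⟨ht.1, ht.2.le.trans hr.2⟩
      have h2 := hmono h1 hr ht.2.le
      have h3 := hg0 t h1
      simp only at h2
      linarith
    linarith
  rw [abs_le]
  constructor
  · have := key (fun t => -f t) (fun t => -f' t) (fun t ht => (hf t ht).fun_neg)
      (fun t ht => (neg_le_abs _).trans (hfg t ht)) (by simpa using hf0.neg)
    linarith
  · exact key f f' hf (fun t ht => (le_abs_self _).trans (hfg t ht)) hf0

lemma not_forall_le_of_tendsto_nhdsGT {μ δ R c : ℝ} (hμ : 1 < μ) (hδ : 0 < δ) (hR : 0 < R)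
    {U V : ℝ → ℝ} (hU : ∀ r, 0 < r → HasDerivAt U (r ^ (-μ) * V r) r)
    (hc : Tendsto U (𝓝[>] 0) (𝓝 c)) : ¬ ∀ r ∈ Set.Ioc 0 R, δ ≤ V r := by
  intro hV
  have hμ' : 0 < μ - 1 := by linarith
  set A : ℝ := δ / (μ - 1) with hA
  have hA0 : 0 < A := by positivity
  have hder : ∀ r ∈ Set.Ioc 0 R, HasDerivAt (fun r => U r + A * r ^ (1 - μ))
      (r ^ (-μ) * V r - δ * r ^ (-μ)) r := by
    intro r hr
    have h := (hU r hr.1).fun_add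
      ((Real.hasDerivAt_rpow_const (p := 1 - μ) (Or.inl hr.1.ne')).const_mul A)
    have e : r ^ (-μ) * V r + A * ((1 - μ) * r ^ (1 - μ - 1)) = r ^ (-μ) * V r - δ * r ^ (-μ) := by
      rw [show (1 : ℝ) - μ - 1 = -μ by ring, hA]
      field_simp
      ring
    rwa [e] at h
  have hmono : MonotoneOn (fun r => U r + A * r ^ (1 - μ)) (Set.Ioc 0 R) :=
    monotoneOn_of_hasDerivWithinAt_nonneg (convex_Ioc 0 R)
      (fun t ht => (hder t ht).continuousAt.continuousWithinAt)
      (fun t ht => (hder t (interior_subset ht)).hasDerivWithinAt)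
      (fun t ht => by
        have ht := interior_subset ht
        have h1 := hV t ht
        have h2 := Real.rpow_pos_of_pos ht.1 (-μ)
        nlinarith)
  have h1 : Tendsto (fun r : ℝ => r ^ (1 - μ)) (𝓝[>] 0) atTop :=
    tendsto_rpow_neg_nhdsGT_zero (by linarith)
  have h2 : Tendsto (fun r => U r + A * r ^ (1 - μ)) (𝓝[>] 0) atTop :=
    hc.add_atTop (h1.const_mul_atTop hA0)
  obtain ⟨t, ht1, ht2⟩ := ((h2.eventually_gt_atTop (U R + A * R ^ (1 - μ))).and
    (Ioc_mem_nhdsGT hR)).exists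
  exact absurd (hmono ht2 ⟨hR, le_rfl⟩ ht2.2) (not_le.2 ht1)

variable {ι : Type*} {μ q : ℝ} {F : ι → (ι → ℝ) → ℝ} {U V : ι → ℝ → ℝ} {c : ι → ℝ}

/-- `U` is a positive solution of `(r^μ Uᵢ')' = -r^q Fᵢ(U)` on `(0, ∞)` with flux `Vᵢ = r^μ Uᵢ'`
and with finite limit `c` at the origin. -/
structure IsRadialProfile (μ q : ℝ) (F : ι → (ι → ℝ) → ℝ) (c : ι → ℝ) (U V : ι → ℝ → ℝ) :
    Prop where
  pos : ∀ i r, 0 < r → 0 < U i r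
  hasDerivAt : ∀ i r, 0 < r → HasDerivAt (U i) (r ^ (-μ) * V i r) r
  hasDerivAt_flux : ∀ i r, 0 < r → HasDerivAt (V i) (-(r ^ q * F i (fun j => U j r))) r
  tendsto : ∀ i, Tendsto (U i) (𝓝[>] 0) (𝓝 (c i))

namespace IsRadialProfile

lemma antitoneOn_flux (hF : ∀ i z, (∀ j, 0 < z j) → 0 < F i z)
    (h : IsRadialProfile μ q F c U V) (i : ι) : AntitoneOn (V i) (Set.Ioi 0) :=
  antitoneOn_of_hasDerivWithinAt_nonpos (convex_Ioi 0)
    (fun t ht => (h.hasDerivAt_flux i t ht).continuousAt.continuousWithinAt)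
    (fun t ht => (h.hasDerivAt_flux i t (interior_subset ht)).hasDerivWithinAt)
    (fun t ht => by
      have ht : 0 < t := interior_subset ht
      have h1 := hF i (fun j => U j t) fun j => h.pos j t ht
      have h2 := Real.rpow_pos_of_pos ht q
      have := mul_pos h2 h1
      linarith)

lemma flux_nonpos (hμ : 1 < μ) (hF : ∀ i z, (∀ j, 0 < z j) → 0 < F i z)
    (h : IsRadialProfile μ q F c U V) (i : ι) {r : ℝ} (hr : 0 < r) : V i r ≤ 0 := by
  by_contra! hV
  exact not_forall_le_of_tendsto_nhdsGT hμ hV hr (h.hasDerivAt i) (h.tendsto i)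
    fun t ht => h.antitoneOn_flux hF i ht.1 hr ht.2

lemma tendsto_flux (hμ : 1 < μ) (hF : ∀ i z, (∀ j, 0 < z j) → 0 < F i z)
    (h : IsRadialProfile μ q F c U V) (i : ι) : Tendsto (V i) (𝓝[>] 0) (𝓝 0) := by
  refine tendsto_order.2 ⟨fun a ha => ?_, fun a ha => ?_⟩
  · have h1 := not_forall_le_of_tendsto_nhdsGT (U := fun r => -U i r) (V := fun r => -V i r)
      (δ := -a) hμ (by linarith) zero_lt_one
      (fun r hr => by simpa using (h.hasDerivAt i r hr).fun_neg) (h.tendsto i).neg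
    push Not at h1
    obtain ⟨r, hr, h2⟩ := h1
    filter_upwards [Ioc_mem_nhdsGT hr.1] with t ht
    have := h.antitoneOn_flux hF i ht.1 hr.1 ht.2
    linarith
  · filter_upwards [self_mem_nhdsWithin] with t ht
    exact (h.flux_nonpos hμ hF i ht).trans_lt ha

lemma antitoneOn (hμ : 1 < μ) (hF : ∀ i z, (∀ j, 0 < z j) → 0 < F i z)
    (h : IsRadialProfile μ q F c U V) (i : ι) : AntitoneOn (U i) (Set.Ioi 0) :=
  antitoneOn_of_hasDerivWithinAt_nonpos (convex_Ioi 0)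
    (fun t ht => (h.hasDerivAt i t ht).continuousAt.continuousWithinAt)
    (fun t ht => (h.hasDerivAt i t (interior_subset ht)).hasDerivWithinAt)
    (fun t ht => by
      have ht : 0 < t := interior_subset ht
      exact mul_nonpos_of_nonneg_of_nonpos (Real.rpow_nonneg ht.le _) (h.flux_nonpos hμ hF i ht))

lemma le_limit (hμ : 1 < μ) (hF : ∀ i z, (∀ j, 0 < z j) → 0 < F i z)
    (h : IsRadialProfile μ q F c U V) (i : ι) {r : ℝ} (hr : 0 < r) : U i r ≤ c i := by
  refine ge_of_tendsto (h.tendsto i) ?_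
  filter_upwards [Ioc_mem_nhdsGT hr] with t ht
  exact h.antitoneOn hμ hF i ht.1 hr ht.2

/-- A radial profile is determined by its value at the origin. -/
theorem unique [Finite ι] {U' V' : ι → ℝ → ℝ} (hμ : 1 < μ) (hq : 0 < q + 1) (hσ : 0 < q + 2 - μ)
    (hF : ∀ i z, (∀ j, 0 < z j) → 0 < F i z)
    (hLip : ∀ c C : ℝ, 0 < c → ∃ L > 0, ∀ i (z z' : ι → ℝ) (M : ℝ), (∀ j, z j ∈ Set.Icc c C) →
      (∀ j, z' j ∈ Set.Icc c C) → (∀ j, |z j - z' j| ≤ M) → |F i z - F i z'| ≤ L * M)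
    (h : IsRadialProfile μ q F c U V) (h' : IsRadialProfile μ q F c U' V') (i : ι) {R : ℝ}
    (hR : 0 < R) : U i R = U' i R := by
  obtain ⟨d, hd, hd0⟩ : ∃ d, (∀ j, d ≤ U j R ∧ d ≤ U' j R) ∧ 0 < d := by
    have h1 : ∀ᶠ d in 𝓝[>] (0 : ℝ), ∀ j, d ≤ U j R ∧ d ≤ U' j R := eventually_all.2 fun j => by
      filter_upwards [Ioc_mem_nhdsGT (h.pos j R hR), Ioc_mem_nhdsGT (h'.pos j R hR)]
        with d hd hd' using ⟨hd.2, hd'.2⟩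
    exact (h1.and self_mem_nhdsWithin).exists
  obtain ⟨C, hC⟩ : ∃ C, ∀ j, c j ≤ C :=
    (eventually_all.2 fun j => eventually_ge_atTop (c j) : ∀ᶠ C in atTop, ∀ j, c j ≤ C).exists
  obtain ⟨L, hL, hLip⟩ := hLip d C hd0
  have hU : ∀ j, ∀ r ∈ Set.Ioc 0 R, U j r ∈ Set.Icc d C := fun j r hr =>
    ⟨(hd j).1.trans (h.antitoneOn hμ hF j hr.1 hR hr.2),
      (h.le_limit hμ hF j hr.1).trans (hC j)⟩
  have hU' : ∀ j, ∀ r ∈ Set.Ioc 0 R, U' j r ∈ Set.Icc d C := fun j r hr =>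
    ⟨(hd j).2.trans (h'.antitoneOn hμ hF j hr.1 hR hr.2),
      (h'.le_limit hμ hF j hr.1).trans (hC j)⟩
  set σ := q + 2 - μ with hσdef
  set K := 2 * L / ((q + 1) * σ) with hK
  have hK0 : 0 < K := by positivity
  have hexp : ∀ r : ℝ, 0 < r → HasDerivAt (fun r : ℝ => Real.exp (K * r ^ σ))
      (K * σ * r ^ (σ - 1) * Real.exp (K * r ^ σ)) r := by
    intro r hr
    have h1 := ((Real.hasDerivAt_rpow_const (p := σ) (Or.inl hr.ne')).const_mul K).exp
    convert h1 using 1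
    ring
  have hstep : ∀ M : ℝ, 0 ≤ M →
      (∀ j, ∀ r ∈ Set.Ioc 0 R, |U j r - U' j r| ≤ M * Real.exp (K * r ^ σ)) →
      ∀ j, ∀ r ∈ Set.Ioc 0 R, |U j r - U' j r| ≤ M / 2 * Real.exp (K * r ^ σ) := by
    intro M hM hbound j r hr
    have hV : ∀ r ∈ Set.Ioc 0 R,
        |V j r - V' j r| ≤ L * M / (q + 1) * (r ^ (q + 1) * Real.exp (K * r ^ σ)) := by
      intro r hr
      refine abs_le_of_abs_hasDerivAt_le (R := R)
        (fun t ht => (h.hasDerivAt_flux j t ht.1).fun_sub (h'.hasDerivAt_flux j t ht.1))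
        (fun t ht => ((Real.hasDerivAt_rpow_const (p := q + 1) (Or.inl ht.1.ne')).fun_mul
          (hexp t ht.1)).const_mul (L * M / (q + 1)))
        (fun t ht => ?_) (fun t ht => ?_) ?_ hr
      · have ht0 := ht.1
        have h1 := hLip j (fun j => U j t) (fun j => U' j t) _ (fun j => hU j t ht)
          (fun j => hU' j t ht) (fun j => hbound j t ht)
        have h2 := Real.rpow_pos_of_pos ht0 q
        have e1 : -(t ^ q * F j fun j => U j t) - -(t ^ q * F j fun j => U' j t)
            = -(t ^ q * ((F j fun j => U j t) - F j fun j => U' j t)) := by ring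
        rw [e1, abs_neg, abs_mul, abs_of_pos h2]
        have h3 : 0 ≤ L * M / (q + 1) *
            (t ^ (q + 1) * (K * σ * t ^ (σ - 1) * Real.exp (K * t ^ σ))) := by positivity
        have e2 : L * M / (q + 1) * ((q + 1) * t ^ (q + 1 - 1) * Real.exp (K * t ^ σ) +
            t ^ (q + 1) * (K * σ * t ^ (σ - 1) * Real.exp (K * t ^ σ)))
            = t ^ q * (L * (M * Real.exp (K * t ^ σ))) + L * M / (q + 1) *
              (t ^ (q + 1) * (K * σ * t ^ (σ - 1) * Real.exp (K * t ^ σ))) := by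
          rw [add_sub_cancel_right]
          field_simp
        rw [e2]
        have h4 := mul_le_mul_of_nonneg_left h1 h2.le
        linarith
      · have ht0 := ht.1
        positivity
      · simpa using (h.tendsto_flux hμ hF j).sub (h'.tendsto_flux hμ hF j)
    refine abs_le_of_abs_hasDerivAt_le (R := R)
      (fun t ht => (h.hasDerivAt j t ht.1).fun_sub (h'.hasDerivAt j t ht.1))
      (fun t ht => (hexp t ht.1).const_mul (M / 2))
      (fun t ht => ?_) (fun t ht => by positivity) ?_ hr
    · have ht0 := ht.1
      have h1 := mul_le_mul_of_nonneg_left (hV t ht) (Real.rpow_nonneg ht0.le (-μ))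
      rw [← mul_sub, abs_mul, abs_of_nonneg (Real.rpow_nonneg ht0.le (-μ))]
      refine h1.trans (le_of_eq ?_)
      have e : t ^ (σ - 1) = t ^ (-μ) * t ^ (q + 1) := by
        rw [← Real.rpow_add ht0, hσdef]
        congr 1
        ring
      rw [e, hK]
      field_simp
    · simpa using (h.tendsto j).sub (h'.tendsto j)
  have hiter : ∀ N : ℕ, ∀ j, ∀ r ∈ Set.Ioc 0 R,
      |U j r - U' j r| ≤ |C - d| / 2 ^ N * Real.exp (K * r ^ σ) := by
    intro N
    induction N with
    | zero =>
      intro j r hr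
      have h1 := hU j r hr
      have h2 := hU' j r hr
      have h3 : |U j r - U' j r| ≤ |C - d| :=
        (abs_le.2 ⟨by linarith [h1.1, h2.2], by linarith [h1.2, h2.1]⟩).trans (le_abs_self _)
      have h4 : 1 ≤ Real.exp (K * r ^ σ) :=
        Real.one_le_exp (mul_nonneg hK0.le (Real.rpow_nonneg hr.1.le _))
      rw [pow_zero, div_one]
      exact h3.trans (le_mul_of_one_le_right (abs_nonneg _) h4)
    | succ N ih =>
      intro j r hr
      have := hstep _ (by positivity) ih j r hr
      rwa [div_div, ← pow_succ] at this
  have hlim : Tendsto (fun N : ℕ => |C - d| / 2 ^ N * Real.exp (K * R ^ σ)) atTop (𝓝 0) := by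
    have h1 : Tendsto (fun N : ℕ => ((2 : ℝ)⁻¹) ^ N) atTop (𝓝 0) :=
      tendsto_pow_atTop_nhds_zero_of_lt_one (by norm_num) (by norm_num)
    have h2 := (h1.const_mul |C - d|).mul_const (Real.exp (K * R ^ σ))
    simpa [div_eq_mul_inv] using h2
  have h0 : |U i R - U' i R| ≤ 0 := ge_of_tendsto' hlim fun N => hiter N i R ⟨hR, le_rfl⟩
  exact sub_eq_zero.1 (abs_nonpos_iff.1 h0)

end IsRadialProfile

end RadialODE

section RadialLaplacian

lemma fderiv_fderiv_real {W : ℝ → ℝ} {r : ℝ} (hW : ContDiffAt ℝ 2 W r) :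
    HasDerivAt (deriv W) (deriv (deriv W) r) r ∧
      ∀ c, fderiv ℝ (fderiv ℝ W) r c c = c ^ 2 * deriv (deriv W) r := by
  have h1 := hW.hasFDerivAt_fderiv_apply 1
  have e : (fun y => fderiv ℝ W y 1) = deriv W := by
    funext y
    exact fderiv_apply_one_eq_deriv
  rw [e] at h1
  refine ⟨h1.differentiableAt.hasDerivAt, fun c => ?_⟩
  have h2 : fderiv ℝ (fderiv ℝ W) r 1 1 = deriv (deriv W) r := by
    have := h1.hasDerivAt.deriv
    rw [this]
    rfl
  have h3 : fderiv ℝ (fderiv ℝ W) r (c • 1) (c • 1) =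
      c • c • fderiv ℝ (fderiv ℝ W) r 1 1 := by
    rw [map_smul, map_smul]
    rfl
  rw [h2] at h3
  simpa [smul_eq_mul, sq, mul_assoc] using h3

variable {E : Type*} [NormedAddCommGroup E] [InnerProductSpace ℝ E]

lemma hasFDerivAt_norm_of_ne {x : E} (hx : x ≠ 0) :
    HasFDerivAt (fun y : E => ‖y‖) (‖x‖⁻¹ • innerSL ℝ x) x := by
  have h := hasFDerivAt_norm_rpow' hx 1
  have e : ‖x‖ ^ ((1 : ℝ) - 2) = ‖x‖⁻¹ := by
    rw [show (1 : ℝ) - 2 = -1 by norm_num, Real.rpow_neg_one]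
  simpa only [Real.rpow_one, one_mul, e] using h

variable [FiniteDimensional ℝ E]

lemma laplacian_radial {W : ℝ → ℝ} {x : E} (hx : x ≠ 0) (hW : ContDiffAt ℝ 2 W ‖x‖) :
    Laplacian.laplacian (fun y : E => W ‖y‖) x
      = deriv (deriv W) ‖x‖ + (Module.finrank ℝ E - 1) / ‖x‖ * deriv W ‖x‖ := by
  have hx' : 0 < ‖x‖ := norm_pos_iff.2 hx
  set v := stdOrthonormalBasis ℝ E
  rw [laplacian_comp (I := fun y : E => ‖y‖) v hW (contDiffAt_norm ℝ hx)]
  have h1 : Laplacian.laplacian (fun y : E => ‖y‖) x = (Module.finrank ℝ E - 1) / ‖x‖ := by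
    have h := laplacian_norm_rpow hx 1
    have e : ‖x‖ ^ ((1 : ℝ) - 2) = ‖x‖⁻¹ := by
      rw [show (1 : ℝ) - 2 = -1 by norm_num, Real.rpow_neg_one]
    simp only [Real.rpow_one, e] at h
    rw [h]
    ring
  have h2 : ∀ c, fderiv ℝ W ‖x‖ c = c * deriv W ‖x‖ := by
    intro c
    rw [fderiv_eq_smul_deriv, smul_eq_mul]
  have h3 : ∑ i, ⟪x, v i⟫_ℝ ^ 2 = ‖x‖ ^ 2 := by
    have := v.sum_sq_norm_inner_left x
    simpa using this
  rw [h1, h2, (hasFDerivAt_norm_of_ne hx).fderiv]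
  simp only [(fderiv_fderiv_real hW).2, smul_apply, innerSL_apply_apply, smul_eq_mul]
  rw [← Finset.sum_mul]
  congr 1
  simp_rw [mul_pow]
  rw [← Finset.mul_sum, h3]
  field_simp

end RadialLaplacian

section Coupling

variable {ι : Type*} [Fintype ι]

lemma exists_lipschitz_coupling (κ α β : ι → ι → ℝ) (c C : ℝ) (hc : 0 < c) :
    ∃ L > 0, ∀ i (z z' : ι → ℝ) (M : ℝ), (∀ j, z j ∈ Set.Icc c C) →
      (∀ j, z' j ∈ Set.Icc c C) → (∀ j, |z j - z' j| ≤ M) →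
      |coupling κ α β i z - coupling κ α β i z'| ≤ L * M := by
  set K : Set (ι → ℝ) := Set.pi Set.univ fun _ => Set.Icc c C with hK
  have hdiff : ∀ i, ContDiffOn ℝ 1 (coupling κ α β i) K := by
    intro i z hz
    have hne : ∀ j, z j ≠ 0 := fun j => (hc.trans_le (hz j (Set.mem_univ j)).1).ne'
    refine ContDiffAt.contDiffWithinAt (ContDiffAt.sum fun j _ => ?_)
    exact (contDiffAt_const.mul ((contDiffAt_apply ℝ ℝ i z).rpow_const_of_ne (hne i))).mul
      ((contDiffAt_apply ℝ ℝ j z).rpow_const_of_ne (hne j))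
  have hL : ∀ i, ∃ L, LipschitzOnWith L (coupling κ α β i) K := fun i =>
    (hdiff i).exists_lipschitzOnWith one_ne_zero (convex_pi fun _ _ => convex_Icc c C)
      (isCompact_univ_pi fun _ => isCompact_Icc)
  choose L hL using hL
  refine ⟨1 + ∑ i, (L i : ℝ), by positivity, fun i z z' M hz hz' hM => ?_⟩
  have hM0 : 0 ≤ M := (abs_nonneg _).trans (hM i)
  have h1 := (hL i).dist_le_mul z (fun j _ => hz j) z' (fun j _ => hz' j)
  have h2 : dist z z' ≤ M := (dist_pi_le_iff hM0).2 fun j => by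
    rw [Real.dist_eq]
    exact hM j
  have h3 : (L i : ℝ) ≤ 1 + ∑ i, (L i : ℝ) := by
    have := Finset.single_le_sum (f := fun i => (L i : ℝ)) (fun j _ => (L j).2)
      (Finset.mem_univ i)
    linarith
  rw [Real.dist_eq] at h1
  exact h1.trans (mul_le_mul h3 h2 dist_nonneg (by positivity))

end Coupling

section Solutions

variable {n : ℕ} {ι : Type*} [Fintype ι] {a b p : ℝ} {κ α β : ι → ι → ℝ}
  {u : ι → EuclideanSpace ℝ (Fin n) → ℝ}

lemma wdiv_radial {W : ℝ → ℝ} {x : EuclideanSpace ℝ (Fin n)} (hx : x ≠ 0)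
    (hW : ContDiffAt ℝ 2 W ‖x‖) :
    wdiv a (fun y => W ‖y‖) x = ‖x‖ ^ (-(2 * a)) *
      (deriv (deriv W) ‖x‖ + (n - 1 - 2 * a) / ‖x‖ * deriv W ‖x‖) := by
  have hx' : 0 < ‖x‖ := norm_pos_iff.2 hx
  have hc : ContDiffAt ℝ 2 (fun y : EuclideanSpace ℝ (Fin n) => W ‖y‖) x :=
    ContDiffAt.comp (g := W) x hW (contDiffAt_norm ℝ hx)
  have hg : ⟪x, gradient (fun y : EuclideanSpace ℝ (Fin n) => W ‖y‖) x⟫_ℝ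
      = ‖x‖ * deriv W ‖x‖ := by
    rw [real_inner_comm, gradient, InnerProductSpace.toDual_symm_apply]
    have h := (hW.differentiableAt (by norm_num)).hasDerivAt.comp_hasFDerivAt x
      (hasFDerivAt_norm_of_ne hx)
    have h' : fderiv ℝ (fun y : EuclideanSpace ℝ (Fin n) => W ‖y‖) x
        = deriv W ‖x‖ • ‖x‖⁻¹ • innerSL ℝ x := h.fderiv
    rw [h']
    simp only [smul_apply, innerSL_apply_apply, smul_eq_mul, real_inner_self_eq_norm_sq]
    field_simp
  rw [wdiv, lapl_eq_laplacian hc, laplacian_radial hx hW, hg]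
  simp only [finrank_euclideanSpace, Fintype.card_fin]
  field_simp
  ring

/-- Positive solutions of the coupled system are radially symmetric about the origin. -/
theorem radial_of_solution (hn : 3 ≤ n) (ha0 : 0 ≤ a) (ha : a < ((n : ℝ) - 2) / 2) (hb0 : 0 < b)
    (hab : a ≤ b) (hp : p = 2 * (n : ℝ) / ((n : ℝ) - 2 + 2 * (b - a)))
    (hκ : ∀ i j, 0 < κ i j) (hα : ∀ i j, 1 < α i j) (hβ : ∀ i j, 1 < β i j)
    (hαβ : ∀ i j, α i j + β i j = p)
    (hreg : ∀ i, ContDiffOn ℝ 2 (u i) {0}ᶜ) (hpos : ∀ i x, x ≠ 0 → 0 < u i x)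
    (heq : ∀ i x, x ≠ 0 →
      -(wdiv a (u i) x) = ‖x‖ ^ (-(b * p)) * coupling κ α β i fun j => u j x)
    (i : ι) {x y : EuclideanSpace ℝ (Fin n)} (hx : x ≠ 0) (hxy : ‖x‖ = ‖y‖) : u i x = u i y := by
  obtain ⟨m, rfl⟩ : ∃ m, n = m + 2 := ⟨n - 2, by omega⟩
  have hm : m ≠ 0 := by omega
  push_cast at ha hp
  have hm0 : (0 : ℝ) < m := by exact_mod_cast Nat.pos_of_ne_zero hm
  have hden : 0 < (m : ℝ) + 2 - 2 + 2 * (b - a) := by linarith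
  have hp0 : 0 < p := by rw [hp]; positivity
  have hpm : p * ((m : ℝ) + 2 - 2 + 2 * (b - a)) = 2 * (m + 2) := by
    rw [hp]
    field_simp
  have hG := kelvinSubcritical_coupling (m := m) (γ := a * (m - a)) (s := (b - a) * p)
    hκ hα hβ hαβ (mul_nonneg ha0 (by linarith)) (mul_nonneg (by linarith) hp0.le)
    (by
      rcases ha0.eq_or_lt with rfl | h
      · right
        rw [sub_zero]
        positivity
      · left
        exact mul_pos h (by linarith))
    (by linarith)
  have hreg' : ∀ i x, x ≠ 0 → ContDiffAt ℝ 2 (u i) x := fun i x hx =>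
    (hreg i).contDiffAt (isOpen_compl_singleton.mem_nhds hx)
  have hw : IsSingularSolution (0 : EuclideanSpace ℝ (Fin (m + 2)))
      (fun i ρ (z : ι → ℝ) => a * (m - a) * ρ ^ (-2 : ℝ) * z i
        + ρ ^ (-((b - a) * p)) * coupling κ α β i z)
      (fun i y => ‖y‖ ^ (-a) * u i y) :=
    { contDiffAt := fun i y hy => (contDiffAt_norm_rpow hy (-a)).mul (hreg' i y hy)
      pos := fun i y hy => mul_pos (Real.rpow_pos_of_pos (norm_pos_iff.2 hy) _) (hpos i y hy)
      laplacian_eq := fun i y hy => by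
        have hy' : 0 < ‖y‖ := norm_pos_iff.2 hy
        rw [laplacian_norm_rpow_mul a hy (hreg' i y hy), sub_zero,
          coupling_smul hαβ i (Real.rpow_pos_of_pos hy' (-a)) (fun j => hpos j y hy)]
        have h := heq i y hy
        have e : ‖y‖ ^ (-((b - a) * p)) * (‖y‖ ^ (-a)) ^ (p - 1)
            = ‖y‖ ^ a * ‖y‖ ^ (-(b * p)) := by
          rw [← Real.rpow_mul hy'.le, ← Real.rpow_add hy', ← Real.rpow_add hy']
          congr 1
          ring
        rw [← mul_assoc (‖y‖ ^ (-((b - a) * p))), e, mul_assoc (‖y‖ ^ a), ← h]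
        push_cast
        ring }
  have h := hw.radial (by simp) hm hG i hxy
  simp only [hxy] at h
  have hy' : 0 < ‖y‖ := hxy ▸ norm_pos_iff.2 hx
  exact mul_left_cancel₀ (Real.rpow_pos_of_pos hy' (-a)).ne' h

/-- A continuous positive solution of the coupled system restricts to a radial profile along any
unit direction. -/
theorem isRadialProfile_of_solution (hn : 3 ≤ n) (ha0 : 0 ≤ a) (ha : a < ((n : ℝ) - 2) / 2)
    (hb0 : 0 < b) (hab : a ≤ b) (hp : p = 2 * (n : ℝ) / ((n : ℝ) - 2 + 2 * (b - a)))
    (hκ : ∀ i j, 0 < κ i j) (hα : ∀ i j, 1 < α i j) (hβ : ∀ i j, 1 < β i j)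
    (hαβ : ∀ i j, α i j + β i j = p)
    (hreg : ∀ i, ContDiffOn ℝ 2 (u i) {0}ᶜ) (hpos : ∀ i x, x ≠ 0 → 0 < u i x)
    (heq : ∀ i x, x ≠ 0 →
      -(wdiv a (u i) x) = ‖x‖ ^ (-(b * p)) * coupling κ α β i fun j => u j x)
    (hcont : ∀ i, Continuous (u i)) {e : EuclideanSpace ℝ (Fin n)} (he : ‖e‖ = 1) :
    (∀ i x, u i x = u i (‖x‖ • e)) ∧
    IsRadialProfile (n - 1 - 2 * a) (n - 1 - b * p) (coupling κ α β) (fun i => u i 0)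
      (fun i r => u i (r • e))
      (fun i r => r ^ ((n : ℝ) - 1 - 2 * a) * deriv (fun r : ℝ => u i (r • e)) r) := by
  have hrad : ∀ i x, u i x = u i (‖x‖ • e) := by
    intro i x
    by_cases hx : x = 0
    · simp [hx]
    · refine radial_of_solution hn ha0 ha hb0 hab hp hκ hα hβ hαβ hreg hpos heq i hx ?_
      rw [norm_smul, he, mul_one, norm_norm]
  refine ⟨hrad, ?_⟩
  have hnorm : ∀ r : ℝ, 0 < r → ‖r • e‖ = r := fun r hr => by
    rw [norm_smul, he, mul_one, Real.norm_of_nonneg hr.le]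
  have hne : ∀ r : ℝ, 0 < r → r • e ≠ 0 := fun r hr => norm_pos_iff.1 (by rwa [hnorm r hr])
  have hC2 : ∀ i r, 0 < r → ContDiffAt ℝ 2 (fun r : ℝ => u i (r • e)) r := fun i r hr =>
    ContDiffAt.comp (f := fun r : ℝ => r • e) (g := u i) r
      ((hreg i).contDiffAt (isOpen_compl_singleton.mem_nhds (hne r hr)))
      (contDiffAt_id.smul contDiffAt_const)
  refine ⟨fun i r hr => hpos i _ (hne r hr), fun i r hr => ?_, fun i r hr => ?_, fun i => ?_⟩
  · rw [← mul_assoc, ← Real.rpow_add hr, neg_add_cancel, Real.rpow_zero, one_mul]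
    exact ((hC2 i r hr).differentiableAt (by norm_num)).hasDerivAt
  · set W : ℝ → ℝ := fun r : ℝ => u i (r • e) with hW
    have h1 := (Real.hasDerivAt_rpow_const (p := (n : ℝ) - 1 - 2 * a) (Or.inl hr.ne')).fun_mul
      (fderiv_fderiv_real (hC2 i r hr)).1
    have hfun : u i = fun y => W ‖y‖ := funext (hrad i)
    have h2 := heq i (r • e) (hne r hr)
    rw [hfun, wdiv_radial (hne r hr) (by rw [hnorm r hr]; exact hC2 i r hr), hnorm r hr] at h2
    have e1 : r ^ ((n : ℝ) - 1 - 2 * a - 1) = r ^ ((n : ℝ) - 1 - 2 * a) / r :=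
      Real.rpow_sub_one hr.ne' _
    have e2 : r ^ ((n : ℝ) - 1 - 2 * a) = r ^ ((n : ℝ) - 1) * r ^ (-(2 * a)) := by
      rw [← Real.rpow_add hr, sub_eq_add_neg ((n : ℝ) - 1)]
    have e3 : r ^ ((n : ℝ) - 1 - b * p) = r ^ ((n : ℝ) - 1) * r ^ (-(b * p)) := by
      rw [← Real.rpow_add hr, sub_eq_add_neg ((n : ℝ) - 1)]
    have e4 : (n - 1 - 2 * a) * r ^ ((n : ℝ) - 1 - 2 * a - 1) * deriv W r
        + r ^ ((n : ℝ) - 1 - 2 * a) * deriv (deriv W) r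
        = -(r ^ ((n : ℝ) - 1 - b * p) * coupling κ α β i fun j => u j (r • e)) := by
      rw [e3, mul_assoc (r ^ ((n : ℝ) - 1)), ← h2, e1, e2]
      ring
    rw [← e4]
    exact h1
  · have h : Continuous fun r : ℝ => u i (r • e) := (hcont i).comp (by fun_prop)
    exact (h.tendsto' 0 _ (by simp)).mono_left nhdsWithin_le_nhds

end Solutions

/-- The exponents of the radial system are those for which the value at the origin determines the
profile. -/
lemma radial_exponents {n a b p : ℝ} (ha0 : 0 ≤ a) (ha : a < (n - 2) / 2) (hab : a ≤ b)
    (hba : b < a + 1) (hp : p = 2 * n / (n - 2 + 2 * (b - a))) :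
    1 < n - 1 - 2 * a ∧ 0 < n - 1 - b * p + 1 ∧ 0 < n - 1 - b * p + 2 - (n - 1 - 2 * a) := by
  have hden : 0 < n - 2 + 2 * (b - a) := by linarith
  have h1 : b * p < n := by
    rw [hp, ← mul_div_assoc, div_lt_iff₀ hden]
    nlinarith
  have h2 : b * p < 2 + 2 * a := by
    rw [hp, ← mul_div_assoc, div_lt_iff₀ hden]
    nlinarith
  exact ⟨by linarith, by linarith, by linarith⟩

theorem stmt {k n : ℕ} (hk : 2 ≤ k) (hn : 3 ≤ n) (a b p : ℝ)
    (ha0 : 0 ≤ a) (ha : a < ((n:ℝ)-2)/2) (hb0 : 0 < b) (hab : a ≤ b) (hba : b < a + 1)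
    (hp : p = 2*(n:ℝ)/((n:ℝ)-2+2*(b-a)))
    (κ α β : Fin k → Fin k → ℝ)
    (hκ : ∀ i j, 0 < κ i j) (hα : ∀ i j, 1 < α i j) (hβ : ∀ i j, 1 < β i j)
    (hαβ : ∀ i j, α i j + β i j = p)
    (u v : Fin k → EuclideanSpace ℝ (Fin n) → ℝ)
    (hureg : ∀ i, ContDiffOn ℝ 2 (u i) {0}ᶜ) (hvreg : ∀ i, ContDiffOn ℝ 2 (v i) {0}ᶜ)
    (hupos : ∀ i, ∀ x : EuclideanSpace ℝ (Fin n), x ≠ 0 → 0 < u i x)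
    (hvpos : ∀ i, ∀ x : EuclideanSpace ℝ (Fin n), x ≠ 0 → 0 < v i x)
    (hueq : ∀ i, ∀ x : EuclideanSpace ℝ (Fin n), x ≠ 0 →
      -(wdiv a (u i) x) = ‖x‖ ^ (-(b*p)) *
        ∑ j, κ i j * u i x ^ (α i j - 1) * u j x ^ (β i j))
    (hveq : ∀ i, ∀ x : EuclideanSpace ℝ (Fin n), x ≠ 0 →
      -(wdiv a (v i) x) = ‖x‖ ^ (-(b*p)) *
        ∑ j, κ i j * v i x ^ (α i j - 1) * v j x ^ (β i j))
    (hEu : ∀ i, finiteEnergy a (u i)) (hEv : ∀ i, finiteEnergy a (v i))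
    (hucont : ∀ i, Continuous (u i)) (hvcont : ∀ i, Continuous (v i))
    (h0 : ∀ i, u i 0 = v i 0) :
    ∀ i, ∀ x : EuclideanSpace ℝ (Fin n), u i x = v i x := by
  set e : EuclideanSpace ℝ (Fin n) := EuclideanSpace.single ⟨0, by lia⟩ 1 with he_def
  have he : ‖e‖ = 1 := by simp [he_def]
  obtain ⟨hu, hU⟩ := isRadialProfile_of_solution hn ha0 ha hb0 hab hp hκ hα hβ hαβ hureg hupos
    hueq hucont he
  obtain ⟨hv, hV⟩ := isRadialProfile_of_solution hn ha0 ha hb0 hab hp hκ hα hβ hαβ hvreg hvpos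
    hveq hvcont he
  rw [show (fun i => u i 0) = fun i => v i 0 from funext h0] at hU
  obtain ⟨hμ, hq, hσ⟩ := radial_exponents ha0 ha hab hba hp
  intro i x
  rcases eq_or_ne x 0 with rfl | hx
  · exact h0 i
  · rw [hu i x, hv i x]
    exact IsRadialProfile.unique hμ hq hσ (fun i z hz => coupling_pos hκ i hz)
      (exists_lipschitz_coupling κ α β) hU hV i (norm_pos_iff.2 hx)
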